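/- Let F be an algebraically closed field of arbitrary characteristic, let n > m ≥ 9, and let X be a subgroup of the alternating group A_n (acting on Ω = {1,…,n}) such that X is isomorphic to the alternating group A_m and X acts primitively on Ω. Then for every F A_n-module V with dim_F V > 1, the restriction of V to X is a reducible F X-module. -/

import Mathlib

/-- A submodule is invariant under a representation. -/
def RepInvariant {F G V : Type*} [Field F] [Monoid G] [AddCommGroup V] [Module F V]
    (ρ : Representation F G V) (p : Submodule F V) : Prop :=
  ∀ g : G, ∀ v ∈ p, ρ g v ∈ p

/-- A representation is irreducible if the space is nonzero and the only invariant
submodules are `⊥` and `⊤`. -/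
def RepIrreducible {F G V : Type*} [Field F] [Monoid G] [AddCommGroup V] [Module F V]
    (ρ : Representation F G V) : Prop :=
  Nontrivial V ∧ ∀ p : Submodule F V, RepInvariant ρ p → p = ⊥ ∨ p = ⊤

/-- A primitive permutation action: transitive and all blocks are trivial. -/
def IsPrimitiveAction (G α : Type*) [Group G] [MulAction G α] : Prop :=
  MulAction.IsPretransitive G α ∧
    ∀ B : Set α, MulAction.IsBlock G B → B.Subsingleton ∨ B = Set.univ

namespace RepIrreducible

variable {F G V : Type*} [Field F] [Group G] [AddCommGroup V] [Module F V]
  {ρ : Representation F G V}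

theorem finiteDimensional [Finite G] (h : RepIrreducible ρ) : FiniteDimensional F V := by
  obtain ⟨_, h2⟩ := h
  obtain ⟨v, hv⟩ := exists_ne (0 : V)
  have key := h2 (Submodule.span F (Set.range fun g => ρ g v)) (by
    intro g w hw
    induction hw using Submodule.span_induction with
    | mem x hx =>
      obtain ⟨k, rfl⟩ := hx
      exact Submodule.subset_span ⟨g * k, by simp⟩
    | zero => simp
    | add x y _ _ hx hy => rw [map_add]; exact Submodule.add_mem _ hx hy
    | smul a x _ hx => rw [map_smul]; exact Submodule.smul_mem _ a hx)
  rcases key with key | key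
  · rw [Submodule.span_eq_bot] at key
    exact absurd (key _ ⟨1, by simp⟩) hv
  · exact ⟨key ▸ Submodule.fg_span (Set.finite_range _)⟩

theorem schur [IsAlgClosed F] [Finite G] (h : RepIrreducible ρ) (T : Module.End F V)
    (hT : ∀ g, T * ρ g = ρ g * T) : ∃ a : F, T = a • 1 := by
  have := h.finiteDimensional
  have := h.1
  obtain ⟨a, ha⟩ := Module.End.exists_eigenvalue T
  refine ⟨a, ?_⟩
  have key := h.2 (Module.End.eigenspace T a) (by
    intro g v hv
    rw [Module.End.mem_eigenspace_iff] at hv ⊢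
    rw [← Module.End.mul_apply, hT, Module.End.mul_apply, hv, map_smul])
  rcases key with key | key
  · exact absurd key ha
  · ext v
    have : v ∈ Module.End.eigenspace T a := key ▸ Submodule.mem_top
    rw [Module.End.mem_eigenspace_iff] at this
    simpa using this

theorem exists_apply_apply_ne_zero (h : RepIrreducible ρ) (L : Module.End F V) (hL : L ≠ 0)
    (v : V) (hv : v ≠ 0) : ∃ g, L (ρ g v) ≠ 0 := by
  by_contra! hc
  have key := h.2 (Submodule.span F (Set.range fun g => ρ g v)) (by
    intro g w hw
    induction hw using Submodule.span_induction with
    | mem x hx =>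
      obtain ⟨k, rfl⟩ := hx
      exact Submodule.subset_span ⟨g * k, by simp⟩
    | zero => simp
    | add x y _ _ hx hy => rw [map_add]; exact Submodule.add_mem _ hx hy
    | smul a x _ hx => rw [map_smul]; exact Submodule.smul_mem _ a hx)
  rcases key with key | key
  · rw [Submodule.span_eq_bot] at key
    exact absurd (key _ ⟨1, by simp⟩) hv
  · apply hL
    have hle : (⊤ : Submodule F V) ≤ LinearMap.ker L := by
      rw [← key, Submodule.span_le]
      rintro _ ⟨g, rfl⟩
      exact hc g
    ext w
    exact hle (Submodule.mem_top : w ∈ _)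

/-- Burnside's theorem on matrix algebras. -/
theorem asAlgebraHom_surjective [IsAlgClosed F] [Finite G] (h : RepIrreducible ρ) :
    Function.Surjective ρ.asAlgebraHom := by
  have := h.finiteDimensional
  have := h.1
  let A := ρ.asAlgebraHom.range
  have hA : ∀ g, ρ g ∈ A := fun g => ⟨MonoidAlgebra.of F G g, by simp⟩
  have hs : IsSimpleModule A V := by
    rw [isSimpleModule_iff]
    refine { toNontrivial := ?_, eq_bot_or_eq_top := fun p => ?_ }
    · infer_instance
    · have := h.2 (p.restrictScalars F) (fun g v hv => p.smul_mem ⟨ρ g, hA g⟩ hv)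
      simpa using this
  intro f
  have hend : ∀ T : Module.End A V, ∃ a : F, ∀ v, T v = a • v := by
    intro T
    obtain ⟨a, ha⟩ := h.schur (T.restrictScalars F) (by
      intro g
      ext v
      exact T.map_smul ⟨ρ g, hA g⟩ v)
    exact ⟨a, fun v => by simpa using LinearMap.congr_fun ha v⟩
  let f' : Module.End (Module.End A V) V :=
    { f with
      map_smul' := by
        intro T v
        obtain ⟨a, ha⟩ := hend T
        change f (T v) = T (f v)
        rw [ha, ha, map_smul] }
  obtain ⟨s, hs⟩ := (Module.Finite.fg_top : (⊤ : Submodule F V).FG)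
  obtain ⟨r, hr⟩ := jacobson_density f' s
  obtain ⟨x, hx⟩ := r.2
  refine ⟨x, ?_⟩
  refine LinearMap.ext_on (s := (s : Set V)) hs ?_
  intro m hm
  have := hr m hm
  change f m = r.1 m at this
  rw [this, ← hx]
  rfl

theorem finrank_sq_le [IsAlgClosed F] [Finite G] (h : RepIrreducible ρ) :
    Module.finrank F V ^ 2 ≤ Nat.card G := by
  have := h.finiteDimensional
  have h1 := LinearMap.finrank_le_finrank_of_surjective
    (f := ρ.asAlgebraHom.toLinearMap) h.asAlgebraHom_surjective
  have := Fintype.ofFinite G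
  have h2 : Module.finrank F (MonoidAlgebra F G) = Nat.card G := by
    rw [Nat.card_eq_fintype_card]
    exact Module.finrank_eq_card_basis (MonoidAlgebra.basis G F)
  rw [h2, Module.finrank_linearMap] at h1
  rwa [sq]

end RepIrreducible

section Transpositions

open Equiv

variable {F V α : Type*} [Field F] [AddCommGroup V] [Module F V] [DecidableEq α]

/-- The transposition attached to an unordered pair. -/
def pairSwap : Sym2 α → Perm α :=
  Sym2.lift ⟨fun x y => swap x y, fun x y => swap_comm x y⟩

@[simp] theorem pairSwap_mk (x y : α) : pairSwap s(x, y) = swap x y := rfl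

theorem pairSwap_map (σ : Perm α) (e : Sym2 α) :
    pairSwap (e.map σ) = σ * pairSwap e * σ⁻¹ := by
  induction e using Sym2.ind with
  | _ x y =>
    rw [Sym2.map_mk, pairSwap_mk, pairSwap_mk, Equiv.mul_swap_eq_swap_mul, mul_assoc]
    simp

/-- If a weighted sum of transpositions is central, then second differences of the weights
give four-term relations between transpositions. -/
theorem second_difference_relation [Fintype α] (ρ : Representation F (Perm α) V) (γ : Sym2 α → F)
    (hc : ∀ σ, (∑ e, γ e • ρ (pairSwap e)) * ρ σ = ρ σ * ∑ e, γ e • ρ (pairSwap e))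
    {a b c d : α} (hab : a ≠ b) (hac : a ≠ c) (had : a ≠ d) (hbc : b ≠ c) (hbd : b ≠ d)
    (hcd : c ≠ d) :
    (γ s(a, c) + γ s(b, d) - γ s(a, d) - γ s(b, c)) •
      (ρ (swap a c) + ρ (swap b d) - ρ (swap a d) - ρ (swap b c)) = 0 := by
  have key : ∀ σ : Perm α, ∑ e, γ (e.map σ) • ρ (pairSwap e) = ∑ e, γ e • ρ (pairSwap e) := by
    intro σ
    have h1 : ∑ e, γ e • ρ (pairSwap e) = ρ σ * (∑ e, γ (e.map σ) • ρ (pairSwap e)) * ρ σ⁻¹ := by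
      rw [Finset.mul_sum, Finset.sum_mul,
        ← (Finite.injective_iff_bijective.1 (Sym2.map.injective σ.injective)).sum_comp]
      refine Finset.sum_congr rfl fun e _ => ?_
      rw [pairSwap_map]
      simp
    have h2 := hc σ
    rw [h1] at h2
    have h3 : ρ σ⁻¹ * ρ σ = 1 := by rw [← map_mul]; simp
    have h4 : ρ σ * ρ σ⁻¹ = 1 := by rw [← map_mul]; simp
    have h5 : ρ σ * (∑ e, γ (e.map σ) • ρ (pairSwap e)) =
        ρ σ * ∑ e, γ e • ρ (pairSwap e) := by
      rw [← hc σ]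
      conv_rhs => rw [h1]
      rw [mul_assoc _ (ρ σ⁻¹), h3, mul_one]
    calc _ = ρ σ⁻¹ * (ρ σ * ∑ e, γ (e.map σ) • ρ (pairSwap e)) := by
            rw [← mul_assoc, h3, one_mul]
      _ = _ := by rw [h5, ← mul_assoc, h3, one_mul]
  let D : Sym2 α → F := fun e =>
    γ e - γ (e.map (swap a b)) - γ (e.map (swap c d)) + γ (e.map (swap a b * swap c d))
  have hD : ∑ e, D e • ρ (pairSwap e) = 0 := by
    simp only [D, sub_smul, add_smul, Finset.sum_sub_distrib, Finset.sum_add_distrib, key]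
    abel
  have hsub : ∑ e ∈ ({s(a, c), s(b, d), s(a, d), s(b, c)} : Finset (Sym2 α)),
      D e • ρ (pairSwap e) = 0 := by
    rw [← hD]
    refine Finset.sum_subset (Finset.subset_univ _) fun e _ he => ?_
    have : D e = 0 := by
      induction e using Sym2.ind with
      | _ x y =>
        simp only [Finset.mem_insert, Finset.mem_singleton, Sym2.eq_iff, not_or] at he
        have hsw : ∀ z, (swap a b * swap c d) z = swap a b (swap c d z) := fun z => rfl
        simp only [D, Sym2.map_mk, hsw]
        by_cases h1 : (x ≠ a ∧ x ≠ b ∧ y ≠ a ∧ y ≠ b) ∨ s(x, y) = s(a, b)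
        · have h2 : s(swap a b x, swap a b y) = s(x, y) := by
            rcases h1 with ⟨h1, h2, h3, h4⟩ | h1
            · rw [swap_apply_of_ne_of_ne h1 h2, swap_apply_of_ne_of_ne h3 h4]
            · rcases Sym2.eq_iff.1 h1 with ⟨rfl, rfl⟩ | ⟨rfl, rfl⟩ <;> simp [Sym2.eq_swap]
          have h3 : s(swap a b (swap c d x), swap a b (swap c d y)) =
              s(swap c d x, swap c d y) := by
            rcases h1 with ⟨h1, h2, h3, h4⟩ | h1
            · have : ∀ z, z ≠ a → z ≠ b → swap c d z ≠ a ∧ swap c d z ≠ b := by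
                intro z _ _
                unfold Equiv.swap Equiv.swapCore
                grind
              rw [swap_apply_of_ne_of_ne (this x h1 h2).1 (this x h1 h2).2,
                swap_apply_of_ne_of_ne (this y h3 h4).1 (this y h3 h4).2]
            · rcases Sym2.eq_iff.1 h1 with ⟨rfl, rfl⟩ | ⟨rfl, rfl⟩ <;>
                simp [swap_apply_of_ne_of_ne hac had, swap_apply_of_ne_of_ne hbc hbd, Sym2.eq_swap]
          rw [h2, h3]
          ring
        · have h2 : s(swap c d x, swap c d y) = s(x, y) := by
            by_cases hh : (x ≠ c ∧ x ≠ d ∧ y ≠ c ∧ y ≠ d)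
            · rw [swap_apply_of_ne_of_ne hh.1 hh.2.1, swap_apply_of_ne_of_ne hh.2.2.1 hh.2.2.2]
            · exfalso
              apply h1
              rw [Sym2.eq_iff]
              grind
          have h3 : s(swap a b (swap c d x), swap a b (swap c d y)) = s(swap a b x, swap a b y) :=
            congrArg (Sym2.map (swap a b)) h2
          rw [h2, h3]
          ring
    rw [this, zero_smul]
  rw [Finset.sum_insert, Finset.sum_insert, Finset.sum_insert, Finset.sum_singleton] at hsub
  · have hsw : ∀ z, (swap a b * swap c d) z = swap a b (swap c d z) := fun z => rfl
    simp only [D, Sym2.map_mk, hsw, swap_apply_left, swap_apply_right,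
      swap_apply_of_ne_of_ne hac.symm hbc.symm, swap_apply_of_ne_of_ne had.symm hbd.symm,
      swap_apply_of_ne_of_ne hac had, swap_apply_of_ne_of_ne hbc hbd, pairSwap_mk] at hsub
    rw [← hsub]
    module
  · simp; grind
  · simp; grind
  · simp; grind

end Transpositions

/-- A symmetric relation on a set with a primitive action that is invariant and neither complete
nor empty has four points with odd second difference. -/
theorem exists_odd_second_difference {G α : Type*} [Group G] [MulAction G α] [Finite α]
    (hprim : IsPrimitiveAction G α) (hcard : 4 ≤ Nat.card α) (γ : α → α → Bool)
    (hsymm : ∀ x y, γ x y = γ y x) (hinv : ∀ (g : G) x y, γ (g • x) (g • y) = γ x y)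
    (hnc : ∃ x y z w, x ≠ y ∧ z ≠ w ∧ γ x y ≠ γ z w) :
    ∃ a b c d, a ≠ b ∧ a ≠ c ∧ a ≠ d ∧ b ≠ c ∧ b ≠ d ∧ c ≠ d ∧
      xor (xor (γ a c) (γ b d)) (xor (γ a d) (γ b c)) = true := by
  classical
  by_contra! hcon
  have hodd : ∀ a b c d, a ≠ b → a ≠ c → a ≠ d → b ≠ c → b ≠ d → c ≠ d →
      xor (γ a c) (γ b c) = xor (γ a d) (γ b d) := by
    intro a b c d h1 h2 h3 h4 h5 h6
    have := hcon a b c d h1 h2 h3 h4 h5 h6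
    revert this
    cases γ a c <;> cases γ b d <;> cases γ a d <;> cases γ b c <;> simp
  have hfresh : ∀ x y z : α, ∃ w, w ≠ x ∧ w ≠ y ∧ w ≠ z := by
    intro x y z
    have := Fintype.ofFinite α
    have h3 : ({x, y, z} : Finset α).card ≤ 3 := Finset.card_le_three
    have : ∃ w, w ∉ ({x, y, z} : Finset α) := by
      by_contra! h
      have : ({x, y, z} : Finset α) = Finset.univ := Finset.eq_univ_iff_forall.2 h
      rw [this, Finset.card_univ, ← Nat.card_eq_fintype_card] at h3
      omega
    simpa using this
  let tw : α → α → Prop := fun x y => ∀ z, z ≠ x → z ≠ y → γ x z = γ y z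
  have tw_of : ∀ x y z, x ≠ y → z ≠ x → z ≠ y → γ x z = γ y z → tw x y := by
    intro x y z hxy hzx hzy h w hwx hwy
    by_cases hzw : z = w
    · rw [← hzw, h]
    · have := hodd x y z w hxy hzx.symm hwx.symm hzy.symm hwy.symm hzw
      rw [h] at this
      revert this
      cases γ x w <;> cases γ y w <;> simp
  have tw_symm : ∀ x y, tw x y → tw y x := fun x y h z h1 h2 => (h z h2 h1).symm
  have tw_trans : ∀ x y z, tw x y → tw y z → tw x z := by
    intro x y z h1 h2
    by_cases hxz : x = z
    · subst hxz; intro w _ _; rfl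
    obtain ⟨w, hx, hy, hz⟩ := hfresh x y z
    exact tw_of x z w hxz hx hz ((h1 w hx hy).trans (h2 w hy hz))
  have tw_inv : ∀ (g : G) x y, tw x y → tw (g • x) (g • y) := by
    intro g x y h z hx hy
    have := h (g⁻¹ • z) (fun h => hx (by rw [← h, smul_inv_smul]))
      (fun h => hy (by rw [← h, smul_inv_smul]))
    rw [← hinv g, ← hinv g y, smul_inv_smul] at this
    exact this
  have tw_all : ∀ x y, tw x y := by
    have hex : ∃ x y, x ≠ y ∧ tw x y := by
      have : Nontrivial α := Finite.one_lt_card_iff_nontrivial.1 (by omega)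
      obtain ⟨x, y, hxy⟩ := exists_pair_ne α
      obtain ⟨w, hwx, hwy, -⟩ := hfresh x y y
      obtain ⟨z, hx, hy, hw⟩ := hfresh x y w
      by_cases h1 : γ x z = γ y z
      · exact ⟨x, y, hxy, tw_of x y z hxy hx hy h1⟩
      by_cases h2 : γ w z = γ y z
      · exact ⟨w, y, hwy, tw_of w y z hwy hw hy h2⟩
      · refine ⟨w, x, hwx, tw_of w x z hwx hw hx ?_⟩
        revert h1 h2
        cases γ x z <;> cases γ y z <;> cases γ w z <;> simp
    obtain ⟨x, y, hxy, htw⟩ := hex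
    have hblock : MulAction.IsBlock G {z | tw x z} := by
      rw [MulAction.isBlock_iff_smul_eq_or_disjoint]
      intro g
      rw [or_iff_not_imp_right, Set.not_disjoint_iff]
      rintro ⟨u, ⟨v, hv, rfl⟩, hu⟩
      have hv' : tw x v := hv
      have hu' : tw x (g • v) := hu
      have hgx : tw x (g • x) := tw_trans _ _ _ hu' (tw_symm _ _ (tw_inv g _ _ hv'))
      ext w
      rw [Set.mem_smul_set_iff_inv_smul_mem]
      change tw x (g⁻¹ • w) ↔ tw x w
      constructor
      · intro h
        have := tw_inv g _ _ h
        rw [smul_inv_smul] at this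
        exact tw_trans _ _ _ hgx this
      · intro h
        have := tw_inv g⁻¹ _ _ (tw_trans _ _ _ (tw_symm _ _ hgx) h)
        rwa [inv_smul_smul] at this
    rcases hprim.2 _ hblock with h | h
    · exact absurd (h (show x ∈ {z | tw x z} from fun _ _ _ => rfl) htw) hxy
    · have hx : ∀ z, tw x z := fun z => by
        have : z ∈ {z | tw x z} := h ▸ Set.mem_univ z
        exact this
      exact fun a b => tw_trans _ _ _ (tw_symm _ _ (hx a)) (hx b)
  obtain ⟨x, y, z, w, hxy, hzw, hne⟩ := hnc
  apply hne
  have step : ∀ a b c, a ≠ c → b ≠ c → γ a c = γ b c := fun a b c h1 h2 =>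
    tw_all a b c h1.symm h2.symm
  by_cases h : z = y
  · subst h
    rw [step x w z hxy hzw.symm, hsymm]
  · rw [step x z y hxy h, hsymm z y, step y w z (Ne.symm h) hzw.symm, hsymm]

section FourTermRelation

open Equiv

variable {F V α : Type*} [Field F] [AddCommGroup V] [Module F V] [DecidableEq α]

/-- The consequences of the four-term relations between transpositions in a representation of a
symmetric group in which central elements act as scalars. -/
theorem threeCycle_of_four_term [Finite α] (hcard : 9 ≤ Nat.card α)
    (ρ : Representation F (Perm α) V)
    (hschur : ∀ T : Module.End F V, (∀ σ, T * ρ σ = ρ σ * T) → ∃ a : F, T = a • 1)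
    (hrel : ∀ a b c d, a ≠ b → a ≠ c → a ≠ d → b ≠ c → b ≠ d → c ≠ d →
      ρ (swap a c) + ρ (swap b d) = ρ (swap a d) + ρ (swap b c)) :
    (∀ a b c, a ≠ b → a ≠ c → b ≠ c → ρ (swap a c * swap b c) = 1) ∨
      ((2 : F) = 0 ∧ ∀ a b c, a ≠ b → a ≠ c → b ≠ c →
        1 + ρ (swap a c * swap b c) + ρ (swap a c * swap b c) ^ 2 = 0) := by
  classical
  have := Fintype.ofFinite α
  have hfresh : ∀ s : Finset α, s.card ≤ 8 → ∃ w, w ∉ s := by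
    intro s hs
    by_contra! h
    have : s = Finset.univ := Finset.eq_univ_iff_forall.2 h
    rw [this, Finset.card_univ, ← Nat.card_eq_fintype_card] at hs
    omega
  have hsq : ∀ a b, ρ (swap a b) * ρ (swap a b) = 1 := fun a b => by
    rw [← map_mul, swap_mul_self, map_one]
  have hdisj : ∀ a b c d, a ≠ c → a ≠ d → b ≠ c → b ≠ d →
      ρ (swap a b) * ρ (swap c d) = ρ (swap c d) * ρ (swap a b) := by
    intro a b c d h1 h2 h3 h4
    rw [← map_mul, ← map_mul]
    congr 1
    rw [Equiv.mul_swap_eq_swap_mul, swap_apply_of_ne_of_ne h1.symm h3.symm,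
      swap_apply_of_ne_of_ne h2.symm h4.symm]
  have hflip : ∀ a b c, a ≠ b → a ≠ c → b ≠ c →
      ρ (swap a c) * ρ (swap b c) = ρ (swap b c) * ρ (swap a b) := by
    intro a b c h1 h2 h3
    rw [← map_mul, ← map_mul]
    congr 1
    rw [Equiv.mul_swap_eq_swap_mul (swap b c), swap_apply_left, swap_apply_of_ne_of_ne h1 h2]
  let t : α → α → Module.End F V := fun a b => ρ (swap a b)
  have tcomm : ∀ a b, t a b = t b a := fun a b => by simp only [t, swap_comm]
  let f : α → α → α → Module.End F V := fun y x k => t y k * t x k - t x k * t y k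
  have f_anti : ∀ y x k, f y x k = - f x y k := fun y x k => by simp only [f]; abel
  have f_step : ∀ x k y j, x ≠ k → y ≠ k → j ≠ k → x ≠ y → x ≠ j → y ≠ j →
      f y x k = t x k * t x j - t x j * t x k := by
    intro x k y j h1 h2 h3 h4 h5 h6
    have e : t x j = t x k + t y j - t y k :=
      eq_sub_of_add_eq (hrel x y j k h4 h5 h1 h6 h2 h3)
    have c := hdisj x k y j h4 h5 h2.symm h3.symm
    change t x k * t y j = t y j * t x k at c
    rw [e]
    simp only [f, mul_add, mul_sub, add_mul, sub_mul, c]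
    abel
  have f_indep : ∀ x k y y', x ≠ k → y ≠ k → y' ≠ k → x ≠ y → x ≠ y' → f y x k = f y' x k := by
    intro x k y y' h1 h2 h3 h4 h5
    obtain ⟨j, hj⟩ := hfresh {x, k, y, y'} (Finset.card_le_four.trans (by norm_num))
    simp only [Finset.mem_insert, Finset.mem_singleton, not_or] at hj
    obtain ⟨j1, j2, j3, j4⟩ := hj
    rw [f_step x k y j h1 h2 j2 h4 (Ne.symm j1) (Ne.symm j3),
      f_step x k y' j h1 h3 j2 h5 (Ne.symm j1) (Ne.symm j4)]
  have f_two : ∀ x y k, x ≠ y → x ≠ k → y ≠ k → f y x k + f y x k = 0 := by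
    intro x y k h1 h2 h3
    obtain ⟨z, hz⟩ := hfresh {x, k, y} (Finset.card_le_three.trans (by norm_num))
    simp only [Finset.mem_insert, Finset.mem_singleton, not_or] at hz
    obtain ⟨z1, z2, z3⟩ := hz
    have : f y x k = - f y x k := calc
      f y x k = - f x y k := f_anti _ _ _
      _ = - f z y k := by rw [f_indep y k x z h3 h2 z2 h1.symm (Ne.symm z3)]
      _ = f y z k := (f_anti _ _ _).symm
      _ = f x z k := by rw [f_indep z k y x z2 h3 h2 z3 z1]
      _ = - f z x k := f_anti _ _ _
      _ = - f y x k := by rw [f_indep x k y z h2 h3 z2 h1 (Ne.symm z1)]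
    exact add_eq_zero_iff_eq_neg.2 this
  have hcube : ∀ a b c, a ≠ b → a ≠ c → b ≠ c →
      (t a c * t b c) * (t a c * t b c) = t b c * t a c := by
    intro a b c h1 h2 h3
    have e1 : t a c * t b c = t b c * t a b := hflip a b c h1 h2 h3
    have e2 : t b a * t c a = t c a * t b c := hflip b c a h3 h1.symm h2.symm
    rw [tcomm b a, tcomm c a] at e2
    have hs : t a c * t a c = 1 := hsq a c
    calc (t a c * t b c) * (t a c * t b c) = (t b c * t a b) * (t a c * t b c) := by
            nth_rewrite 1 [e1]; rfl
      _ = t b c * (t a b * t a c) * t b c := by noncomm_ring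
      _ = t b c * t a c * (t b c * t b c) := by rw [e2]; noncomm_ring
      _ = t b c * t a c := by rw [show t b c * t b c = 1 from hsq b c, mul_one]
  have hcube1 : ∀ a b c, a ≠ b → a ≠ c → b ≠ c →
      (t a c * t b c) * (t b c * t a c) = 1 := by
    intro a b c h1 h2 h3
    rw [mul_assoc, ← mul_assoc (t b c), show t b c * t b c = 1 from hsq b c, one_mul]
    exact hsq a c
  by_cases h2 : (2 : F) = 0
  swap
  · left
    intro a b c h1 h2' h3
    have h0 : f b a c = 0 := by
      have := f_two a b c h1 h2' h3
      rw [← two_smul F] at this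
      exact (smul_eq_zero.1 this).resolve_left h2
    have hc : t b c * t a c = t a c * t b c := sub_eq_zero.1 h0
    have e := hcube a b c h1 h2' h3
    have e' := hcube1 a b c h1 h2' h3
    have inv' : (t b c * t a c) * (t a c * t b c) = 1 := hcube1 b a c h1.symm h3 h2'
    rw [map_mul]
    change t a c * t b c = 1
    calc t a c * t b c = ((t b c * t a c) * (t a c * t b c)) * (t a c * t b c) := by
          rw [inv', one_mul]
      _ = (t b c * t a c) * ((t a c * t b c) * (t a c * t b c)) := by rw [mul_assoc]
      _ = (t a c * t b c) * (t b c * t a c) := by rw [e, hc]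
      _ = 1 := e'
  · have hneg : ∀ T : Module.End F V, -T = T := fun T => by
      have : T + T = 0 := by rw [← two_smul F T, h2, zero_smul]
      exact (eq_neg_of_add_eq_zero_left this).symm
    let h : α → α → α → Module.End F V := fun x y k => t y k * t x k + t x k * t y k
    have hf : ∀ x y k, h x y k = f y x k := fun x y k => by
      simp only [h, f, sub_eq_add_neg, hneg]
    have h_swap : ∀ x y k, h x y k = h y x k := fun x y k => by simp only [h]; abel
    have h_indep : ∀ x k y y', x ≠ k → y ≠ k → y' ≠ k → x ≠ y → x ≠ y' → h x y k = h x y' k := by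
      intro x k y y' h1 h2 h3 h4 h5
      rw [hf, hf, f_indep x k y y' h1 h2 h3 h4 h5]
    have h_rot : ∀ x y k, x ≠ y → x ≠ k → y ≠ k → h x y k = h k y x := by
      intro x y k h1 h2 h3
      have e2 : t y k * t x k = t x k * t y x := hflip y x k h1.symm h3 h2
      have e3 : t y x * t k x = t k x * t y k := hflip y k x h3 h1.symm h2.symm
      simp only [h]
      rw [e2, e3, tcomm k x]
      abel
    have h_fst : ∀ x x' y k, x ≠ y → x ≠ k → y ≠ k → x' ≠ y → x' ≠ k → h x y k = h x' y k := by
      intro x x' y k h1 h2 h3 h4 h5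
      rw [h_swap x, h_swap x', h_indep y k x x' h3 h2 h5 h1.symm h4.symm]
    have h_trd : ∀ x y k k', x ≠ y → x ≠ k → y ≠ k → x ≠ k' → y ≠ k' → h x y k = h x y k' := by
      intro x y k k' h1 h2 h3 h4 h5
      rw [h_rot x y k h1 h2 h3, h_rot x y k' h1 h4 h5,
        h_fst k k' y x h3.symm h2.symm h1.symm h5.symm h4.symm]
    have h_const : ∀ x y k x' y' k', x ≠ y → x ≠ k → y ≠ k → x' ≠ y' → x' ≠ k' → y' ≠ k' →
        h x y k = h x' y' k' := by
      intro x y k x' y' k' h1 h2 h3 h1' h2' h3'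
      obtain ⟨p, hp⟩ := hfresh {x, y, k, x', y', k'} (Finset.card_le_six.trans (by norm_num))
      obtain ⟨q, hq⟩ := hfresh (insert p {x, y, k, x', y', k'})
        ((Finset.card_insert_le _ _).trans
          (Nat.succ_le_of_lt (Finset.card_le_six.trans_lt (by norm_num))))
      obtain ⟨r, hr⟩ := hfresh (insert q (insert p {x, y, k, x', y', k'}))
        ((Finset.card_insert_le _ _).trans (Nat.succ_le_of_lt ((Finset.card_insert_le _ _).trans_lt
          (Nat.lt_of_le_of_lt (Nat.succ_le_succ Finset.card_le_six) (by norm_num)))))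
      simp only [Finset.mem_insert, Finset.mem_singleton, not_or] at hp hq hr
      obtain ⟨p1, p2, p3, p4, p5, p6⟩ := hp
      obtain ⟨q0, q1, q2, q3, q4, q5, q6⟩ := hq
      obtain ⟨r7, r0, r1, r2, r3, r4, r5, r6⟩ := hr
      have main : ∀ x y k, x ≠ y → x ≠ k → y ≠ k → p ≠ y → p ≠ k → q ≠ k →
          h x y k = h p q r := by
        intro x y k h1 h2 h3 a1 a2 a3
        rw [h_fst x p y k h1 h2 h3 a1 a2, h_indep p k y q a2 h3 a3 a1 (Ne.symm q0),
          h_trd p q k r (Ne.symm q0) a2 a3 (Ne.symm r0) (Ne.symm r7)]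
      rw [main x y k h1 h2 h3 p2 p3 q3, main x' y' k' h1' h2' h3' p5 p6 q6]
    have hconj : ∀ (σ : Perm α) x y, ρ σ * t x y = t (σ x) (σ y) * ρ σ := by
      intro σ x y
      simp only [t]
      rw [← map_mul, ← map_mul, Equiv.mul_swap_eq_swap_mul]
    have main : ∀ a b c, a ≠ b → a ≠ c → b ≠ c →
        (h a b c = 0 → t a c * t b c = 1) ∧
        (h a b c = 0 ∨ 1 + t a c * t b c + (t a c * t b c) * (t a c * t b c) = 0) := by
      intro a b c hab hac hbc
      obtain ⟨r, hr⟩ := hschur (h a b c) (by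
        intro σ
        have e1 : h a b c = h (σ a) (σ b) (σ c) :=
          h_const _ _ _ _ _ _ hab hac hbc (by simpa) (by simpa) (by simpa)
        conv_lhs => rw [e1]
        simp only [h]
        rw [mul_add, add_mul, mul_assoc, mul_assoc, ← hconj, ← hconj, ← mul_assoc, ← mul_assoc,
          ← hconj, ← hconj, mul_assoc, mul_assoc])
      have hc2 := hcube a b c hab hac hbc
      have hc3 := hcube1 a b c hab hac hbc
      rw [← hc2] at hc3
      have hh : t a c * t b c + (t a c * t b c) * (t a c * t b c) = h a b c := by
        rw [hc2]
        simp only [h]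
        abel
      set s := t a c * t b c with hs
      have he : 1 + s + s * s = (1 + r) • (1 : Module.End F V) := by
        rw [add_assoc, hh, hr, add_smul, one_smul]
      have h3 : (3 : Module.End F V) = 1 := by
        have : (1 : Module.End F V) + 1 = 0 := by
          rw [← two_smul F (1 : Module.End F V), h2, zero_smul]
        calc (3 : Module.End F V) = 1 + 1 + 1 := by norm_num
          _ = 1 := by rw [this, zero_add]
      have hidem : (1 + s + s * s) * (1 + s + s * s) = 1 + s + s * s := by
        calc (1 + s + s * s) * (1 + s + s * s)
            = 1 + 2 * s + 3 * (s * s) + 2 * (s * (s * s)) + s * (s * (s * s)) := by noncomm_ring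
          _ = 3 * (1 + s + s * s) := by rw [hc3]; noncomm_ring
          _ = 1 + s + s * s := by rw [h3, one_mul]
      have hfac : r • (1 + s + s * s) = 0 := by
        nth_rewrite 1 [he] at hidem
        rw [smul_mul_assoc, one_mul, add_smul, one_smul] at hidem
        exact add_eq_left.1 hidem
      refine ⟨fun h0 => ?_, ?_⟩
      · rw [h0] at hh
        have h1s : 1 + s = 0 := by
          calc 1 + s = s * (s * s) + s * s * (s * s) := by
                rw [hc3, mul_assoc s s, hc3, mul_one]
            _ = (s + s * s) * (s * s) := by noncomm_ring
            _ = 0 := by rw [hh, zero_mul]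
        rw [← hneg s]
        exact (eq_neg_of_add_eq_zero_left h1s).symm
      · rcases smul_eq_zero.1 hfac with h0 | h0
        · left
          rw [hr, h0, zero_smul]
        · exact Or.inr h0
    by_cases hall : ∀ a b c, a ≠ b → a ≠ c → b ≠ c →
        1 + t a c * t b c + (t a c * t b c) * (t a c * t b c) = 0
    · right
      refine ⟨h2, fun a b c hab hac hbc => ?_⟩
      rw [map_mul, sq]
      exact hall a b c hab hac hbc
    · left
      push Not at hall
      obtain ⟨a, b, c, hab, hac, hbc, hne⟩ := hall
      have h0 := (main a b c hab hac hbc).2.resolve_right hne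
      intro a' b' c' hab' hac' hbc'
      rw [map_mul]
      refine (main a' b' c' hab' hac' hbc').1 ?_
      rw [h_const a' b' c' a b c hab' hac' hbc' hab hac hbc, h0]

end FourTermRelation

section Extension

open Equiv Equiv.Perm

variable {F V α : Type*} [Field F] [AddCommGroup V] [Module F V] [DecidableEq α] [Fintype α]

theorem exists_extension_perm (ρ : Representation F (alternatingGroup α) V) (η : Perm α)
    (hη : sign η = -1) (hηη : η * η = 1) (θ : Module.End F V) (hθ : θ * θ = 1)
    (hconj : ∀ g, θ * ρ g = ρ (MulAut.conjNormal η g) * θ) :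
    ∃ ρ' : Representation F (Perm α) V, ∀ g : alternatingGroup α, ρ' g = ρ g := by
  classical
  have hinv : η⁻¹ = η := inv_eq_of_mul_eq_one_left hηη
  have hmem : ∀ σ : Perm α, σ ∉ alternatingGroup α → σ * η ∈ alternatingGroup α := by
    intro σ hσ
    rw [mem_alternatingGroup] at hσ ⊢
    rw [Perm.sign_mul, hη]
    rcases Int.units_eq_one_or (sign σ) with h | h
    · exact absurd h hσ
    · rw [h]; rfl
  let r : Perm α → Module.End F V := fun σ =>
    if h : σ ∈ alternatingGroup α then ρ ⟨σ, h⟩ else ρ ⟨σ * η, hmem σ h⟩ * θ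
  have r_even : ∀ σ (h : σ ∈ alternatingGroup α), r σ = ρ ⟨σ, h⟩ := fun σ h => dif_pos h
  have r_odd : ∀ σ (h : σ ∉ alternatingGroup α), r σ = ρ ⟨σ * η, hmem σ h⟩ * θ :=
    fun σ h => dif_neg h
  refine ⟨{ toFun := r, map_one' := ?_, map_mul' := ?_ }, fun g => r_even g g.2⟩
  · rw [r_even 1 (one_mem _)]
    exact map_one ρ
  · intro σ τ
    by_cases h1 : σ ∈ alternatingGroup α <;> by_cases h2 : τ ∈ alternatingGroup α
    · rw [r_even _ h1, r_even _ h2, r_even _ (mul_mem h1 h2), ← map_mul]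
      rfl
    · have h3 : σ * τ ∉ alternatingGroup α := by
        rwa [Subgroup.mul_mem_cancel_left _ h1]
      rw [r_even _ h1, r_odd _ h2, r_odd _ h3, ← mul_assoc, ← map_mul]
      rfl
    · have h3 : σ * τ ∉ alternatingGroup α := by
        rwa [Subgroup.mul_mem_cancel_right _ h2]
      rw [r_odd _ h1, r_even _ h2, r_odd _ h3, mul_assoc (ρ _) θ, hconj, ← mul_assoc, ← map_mul]
      congr 2
      ext1
      simp only [Subgroup.coe_mul, MulAut.conjNormal_apply, hinv]
      rw [mul_assoc σ η, ← mul_assoc η, ← mul_assoc η, hηη, one_mul, mul_assoc]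
    · have h3 : σ * τ ∈ alternatingGroup α := by
        rw [mem_alternatingGroup] at *
        rw [Perm.sign_mul, (Int.units_eq_one_or _).resolve_left h1,
          (Int.units_eq_one_or _).resolve_left h2]
        rfl
      rw [r_odd _ h1, r_odd _ h2, r_even _ h3, mul_assoc, ← mul_assoc θ, hconj, mul_assoc _ θ,
        hθ, mul_one, ← map_mul]
      congr 2
      ext1
      simp only [MulAut.conjNormal_apply, hinv]
      rw [mul_assoc σ η, ← mul_assoc η, ← mul_assoc η, hηη, one_mul, mul_assoc, hηη, mul_one]

/-- A nonzero operator that is bi-invariant under the even permutations with support off a small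
set forces an irreducible representation of an alternating group to extend to the symmetric
group. -/
theorem exists_extension_of_biinvariant (ρ : Representation F (alternatingGroup α) V)
    (hirr : RepIrreducible ρ) (P : Module.End F V) (hP : P ≠ 0) (Δ : Finset α)
    (hΔ : 2 * Δ.card + 2 ≤ Fintype.card α)
    (hinv : ∀ g : alternatingGroup α, (∃ x y z w, x ∉ Δ ∧ y ∉ Δ ∧ z ∉ Δ ∧ w ∉ Δ ∧
      (g : Perm α) = swap x y * swap z w) → ρ g * P = P ∧ P * ρ g = P) :
    ∃ ρ' : Representation F (Perm α) V, ∀ g : alternatingGroup α, ρ' g = ρ g := by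
  have two_off : ∀ s : Finset α, s.card + 2 ≤ Fintype.card α → ∃ p q, p ≠ q ∧ p ∉ s ∧ q ∉ s := by
    intro s hs
    have : 1 < sᶜ.card := by rw [Finset.card_compl]; omega
    obtain ⟨p, hp, q, hq, hpq⟩ := Finset.one_lt_card.1 this
    exact ⟨p, q, hpq, Finset.mem_compl.1 hp, Finset.mem_compl.1 hq⟩
  obtain ⟨u, v, huv, hu, hv⟩ := two_off Δ (by omega)
  set η : Perm α := swap u v with hηdef
  have hη : sign η = -1 := sign_swap huv
  have hηη : η * η = 1 := swap_mul_self u v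
  have hηi : η⁻¹ = η := swap_inv u v
  let c : alternatingGroup α ≃* alternatingGroup α := MulAut.conjNormal η
  have hc : ∀ g, (c g : Perm α) = η * g * η := fun g => by
    simp only [c, MulAut.conjNormal_apply, hηi]
  have hcc : ∀ g, c (c g) = g := fun g => by
    ext1
    rw [hc, hc, ← mul_assoc, ← mul_assoc, hηη, one_mul, mul_assoc, hηη, mul_one]
  have key : ∀ h : alternatingGroup α, P * ρ (c h) * P = P * ρ h * P := by
    intro h
    obtain ⟨p, q, hpq, hp, hq⟩ := two_off (Δ ∪ Δ.image (h : Perm α)) (by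
      have := Finset.card_union_le Δ (Δ.image (h : Perm α))
      have := Finset.card_image_le (s := Δ) (f := (h : Perm α))
      omega)
    simp only [Finset.mem_union, not_or, Finset.mem_image, not_exists, not_and] at hp hq
    let κ : Perm α := swap p q
    let κ' : Perm α := swap ((h : Perm α)⁻¹ p) ((h : Perm α)⁻¹ q)
    have m1 : η * κ ∈ alternatingGroup α := by
      rw [mem_alternatingGroup, Perm.sign_mul, hη, sign_swap hpq]; rfl
    have m2 : κ' * η ∈ alternatingGroup α := by
      rw [mem_alternatingGroup, Perm.sign_mul, hη, sign_swap (by simpa using hpq)]; rfl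
    have e : c h = ⟨η * κ, m1⟩ * h * ⟨κ' * η, m2⟩ := by
      ext1
      rw [hc]
      simp only [Subgroup.coe_mul]
      have : (h : Perm α) * κ' = κ * h := by
        simp only [κ', κ]
        rw [Equiv.mul_swap_eq_swap_mul]
        simp
      calc η * (h : Perm α) * η = η * (κ * κ) * h * η := by
            rw [show κ * κ = 1 from swap_mul_self p q, mul_one]
        _ = η * κ * (κ * h) * η := by simp only [mul_assoc]
        _ = _ := by rw [← this]; simp only [mul_assoc]
    have i1 : P * ρ ⟨η * κ, m1⟩ = P := (hinv _ ⟨u, v, p, q, hu, hv, hp.1, hq.1, rfl⟩).2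
    have i2 : ρ ⟨κ' * η, m2⟩ * P = P := by
      refine (hinv _ ⟨_, _, u, v, ?_, ?_, hu, hv, rfl⟩).1
      · intro hm; exact hp.2 _ hm (by simp)
      · intro hm; exact hq.2 _ hm (by simp)
    rw [e, map_mul, map_mul]
    calc _ = (P * ρ ⟨η * κ, m1⟩) * ρ h * (ρ ⟨κ' * η, m2⟩ * P) := by simp only [mul_assoc]
      _ = _ := by rw [i1, i2]
  obtain ⟨w, hw⟩ : ∃ w, P w ≠ 0 := by
    by_contra! h
    exact hP (LinearMap.ext h)
  set v0 := P w with hv0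
  let ev : (alternatingGroup α →₀ F) →ₗ[F] V := Finsupp.linearCombination F fun g => ρ g v0
  let C : (alternatingGroup α →₀ F) →ₗ[F] (alternatingGroup α →₀ F) := Finsupp.lmapDomain F F c
  have ev_single : ∀ g, ev (Finsupp.single g 1) = ρ g v0 := fun g => by simp [ev]
  have C_single : ∀ g, C (Finsupp.single g 1) = Finsupp.single (c g) 1 := fun g => by simp [C]
  have hev : Function.Surjective ev := by
    rw [← LinearMap.range_eq_top]
    refine (hirr.2 (LinearMap.range ev) ?_).resolve_left ?_
    · rintro g _ ⟨x, rfl⟩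
      induction x using Finsupp.induction_linear with
      | zero => simp
      | add x y hx hy => rw [map_add, map_add]; exact Submodule.add_mem _ hx hy
      | single k a =>
        refine ⟨Finsupp.single (g * k) a, ?_⟩
        simp [ev]
    · intro hb
      have : ev (Finsupp.single 1 1) ∈ LinearMap.range ev := ⟨_, rfl⟩
      rw [hb, ev_single] at this
      exact hw (by simpa using this)
  have hker : ∀ x, ev x = 0 → ev (C x) = 0 := by
    intro x hx
    by_contra hne
    obtain ⟨g, hg⟩ := hirr.exists_apply_apply_ne_zero P hP _ hne
    apply hg
    have : ∀ y, P (ρ g (ev (C y))) = P (ρ (c g) (ev y)) := by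
      intro y
      induction y using Finsupp.induction_linear with
      | zero => simp
      | add x y hx hy => simp only [map_add, hx, hy]
      | single k a =>
        have hs : (Finsupp.single k a : alternatingGroup α →₀ F) = a • Finsupp.single k 1 := by simp
        rw [hs]
        simp only [map_smul, C_single, ev_single]
        congr 1
        have := LinearMap.congr_fun (key (c g * k)) w
        rw [map_mul, hcc, map_mul, map_mul] at this
        exact this
    rw [this, hx, map_zero, map_zero]
  obtain ⟨s, hs⟩ := ev.exists_rightInverse_of_surjective (LinearMap.range_eq_top.2 hev)
  let θ : Module.End F V := ev ∘ₗ C ∘ₗ s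
  have hθ : ∀ x, θ (ev x) = ev (C x) := by
    intro x
    have : ev (s (ev x) - x) = 0 := by
      rw [map_sub, sub_eq_zero]
      exact LinearMap.congr_fun hs (ev x)
    have := hker _ this
    rw [map_sub, map_sub, sub_eq_zero] at this
    exact this
  have hθ1 : ∀ g, θ (ρ g v0) = ρ (c g) v0 := fun g => by
    rw [← ev_single, hθ, C_single, ev_single]
  have ext_v0 : ∀ S T : Module.End F V, (∀ g, S (ρ g v0) = T (ρ g v0)) → S = T := by
    intro S T h
    have : S ∘ₗ ev = T ∘ₗ ev := by
      ext g
      simpa [ev] using h g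
    ext x
    obtain ⟨y, rfl⟩ := hev x
    exact LinearMap.congr_fun this y
  refine exists_extension_perm ρ η hη hηη θ (ext_v0 _ _ fun g => ?_)
    fun g => ext_v0 _ _ fun k => ?_
  · rw [Module.End.mul_apply, hθ1, hθ1, hcc]
    rfl
  · have hρ : ∀ a b x, ρ a (ρ b x) = ρ (a * b) x := fun a b x => by rw [map_mul]; rfl
    rw [Module.End.mul_apply, Module.End.mul_apply, hρ, hθ1, hθ1, hρ, map_mul]

end Extension

section Nonextendability

open Equiv Equiv.Perm

theorem Equiv.Perm.IsThreeCycle.exists_eq_swap_mul_swap {α : Type*} [Fintype α] [DecidableEq α]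
    {g : Perm α} (hg : g.IsThreeCycle) :
    ∃ a b c, a ≠ b ∧ a ≠ c ∧ b ≠ c ∧ g = swap a c * swap b c := by
  obtain ⟨x, hx⟩ : ∃ x, x ∈ g.support := by
    rw [← Finset.Nonempty, ← Finset.card_pos, hg.card_support]
    norm_num
  have hn := hg.nodup_iff_mem_support.2 hx
  have he := hg.eq_swap_mul_swap_iff_mem_support.2 hx
  simp only [List.nodup_cons, List.mem_cons, List.not_mem_nil, or_false, not_or] at hn
  refine ⟨x, g (g x), g x, hn.1.2, hn.1.1, Ne.symm hn.2.1, ?_⟩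
  rwa [swap_comm (g (g x))]

theorem RepIrreducible.rank_le_one_of_trivial {F G V : Type*} [Field F] [Group G] [AddCommGroup V]
    [Module F V] {ρ : Representation F G V} (h : RepIrreducible ρ) (ht : ∀ g, ρ g = 1) :
    Module.rank F V ≤ 1 := by
  have := h.1
  obtain ⟨v, hv⟩ := exists_ne (0 : V)
  rw [rank_le_one_iff]
  refine ⟨v, fun w => ?_⟩
  have htop := (h.2 (Submodule.span F {v}) (fun g x hx => by rwa [ht])).resolve_left (by
    rwa [Submodule.span_singleton_eq_bot])
  exact Submodule.mem_span_singleton.1 (htop ▸ Submodule.mem_top : w ∈ Submodule.span F {v})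

theorem RepIrreducible.of_comp {F G H V : Type*} [Field F] [Group G] [Group H] [AddCommGroup V]
    [Module F V] {ρ : Representation F G V} {f : H →* G} (h : RepIrreducible (ρ.comp f)) :
    RepIrreducible ρ :=
  ⟨h.1, fun p hp => h.2 p fun g v hv => hp (f g) v hv⟩

/-- If a representation of a symmetric group stays irreducible on a primitive subgroup that is not
transitive on unordered pairs, then the characteristic is two and the three-cycles have
minimal polynomial `1 + X + X ^ 2`. -/
theorem two_eq_zero_of_extension {F V α : Type*} [Field F] [IsAlgClosed F] [AddCommGroup V]
    [Module F V] [DecidableEq α] [Fintype α] (hcard : 9 ≤ Fintype.card α)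
    (X : Subgroup (alternatingGroup α)) (hprim : IsPrimitiveAction X α)
    (hpairs : ∃ x y z w : α, x ≠ y ∧ z ≠ w ∧ ∀ g ∈ X, s(g • x, g • y) ≠ s(z, w))
    (ρ : Representation F (alternatingGroup α) V) (hdim : 1 < Module.rank F V)
    (hirr : RepIrreducible (ρ.comp X.subtype)) (ρ' : Representation F (Perm α) V)
    (hext : ∀ g : alternatingGroup α, ρ' g = ρ g) :
    (2 : F) = 0 ∧ ∀ s : alternatingGroup α, (s : Perm α).IsThreeCycle →
      1 + ρ s + ρ s ^ 2 = 0 := by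
  classical
  obtain ⟨x0, y0, z0, w0, hxy, hzw, hnot⟩ := hpairs
  have schur : ∀ T : Module.End F V, (∀ g ∈ X, T * ρ g = ρ g * T) → ∃ a : F, T = a • 1 :=
    fun T hT => hirr.schur T fun g => hT g g.2
  let γ : α → α → Bool := fun x y => decide (∃ g ∈ X, s(g • x0, g • y0) = s(x, y))
  have γ_inv : ∀ (g : X) x y, γ (g • x) (g • y) = γ x y := by
    intro g x y
    simp only [γ, decide_eq_decide]
    have hmap : ∀ (k : alternatingGroup α) (a b c d : α),
        s(a, b) = s(c, d) → s(k • a, k • b) = s(k • c, k • d) := fun k a b c d h =>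
      congrArg (Sym2.map (k • ·)) h
    constructor
    · rintro ⟨k, hk, h⟩
      refine ⟨(g : alternatingGroup α)⁻¹ * k, mul_mem (inv_mem g.2) hk, ?_⟩
      have := hmap (g : alternatingGroup α)⁻¹ _ _ _ _ h
      simp only [mul_smul]
      rw [this]
      congr 2
      · exact inv_smul_smul (g : alternatingGroup α) x
      · exact inv_smul_smul (g : alternatingGroup α) y
    · rintro ⟨k, hk, h⟩
      refine ⟨(g : alternatingGroup α) * k, mul_mem g.2 hk, ?_⟩
      simp only [mul_smul]
      exact hmap (g : alternatingGroup α) _ _ _ _ h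
  obtain ⟨a, b, c, d, hab, hac, had, hbc, hbd, hcd, hodd⟩ :=
    exists_odd_second_difference hprim (by rw [Nat.card_eq_fintype_card]; omega) γ
      (fun x y => by simp only [γ, Sym2.eq_swap]) γ_inv
      ⟨x0, y0, z0, w0, hxy, hzw, by
        have h1 : γ x0 y0 = true := by
          simp only [γ, decide_eq_true_eq]
          exact ⟨1, one_mem _, by simp⟩
        have h2 : γ z0 w0 = false := by
          simp only [γ, decide_eq_false_iff_not]
          rintro ⟨g, hg, h⟩
          exact hnot g hg h
        simp [h1, h2]⟩
  let Γ : Sym2 α → F := fun e => if ∃ g ∈ X, s(g • x0, g • y0) = e then 1 else 0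
  have Γγ : ∀ x y, Γ s(x, y) = if γ x y then 1 else 0 := fun x y => by simp [Γ, γ]
  have Γinv : ∀ g ∈ X, ∀ e : Sym2 α, Γ (e.map (g • ·)) = Γ e := by
    intro g hg e
    induction e using Sym2.ind with
    | _ x y =>
      rw [Sym2.map_mk, Γγ, Γγ]
      exact congrArg (fun b : Bool => if b = true then (1 : F) else 0) (γ_inv ⟨g, hg⟩ x y)
  have central : ∃ r : F, ∑ e, Γ e • ρ' (pairSwap e) = r • (1 : Module.End F V) := by
    apply schur
    intro g hg
    rw [← hext, Finset.mul_sum, Finset.sum_mul, ← (Finite.injective_iff_bijective.1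
      (Sym2.map.injective (g : Perm α).injective)).sum_comp]
    refine Finset.sum_congr rfl fun e _ => ?_
    have h1 : Γ (e.map (g : Perm α)) = Γ e := Γinv g hg e
    rw [h1, pairSwap_map, smul_mul_assoc, mul_smul_comm, ← map_mul, ← map_mul]
    simp
  obtain ⟨r, hr⟩ := central
  have rel := second_difference_relation ρ' Γ (fun σ => by rw [hr]; simp) hab hac had hbc hbd hcd
  have rel0 : ρ' (swap a c) + ρ' (swap b d) - ρ' (swap a d) - ρ' (swap b c) = 0 := by
    refine (smul_eq_zero.1 rel).resolve_left ?_
    simp only [Γγ]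
    revert hodd
    cases γ a c <;> cases γ b d <;> cases γ a d <;> cases γ b c <;> simp
  have hrel : ∀ a b c d, a ≠ b → a ≠ c → a ≠ d → b ≠ c → b ≠ d → c ≠ d →
      ρ' (swap a c) + ρ' (swap b d) = ρ' (swap a d) + ρ' (swap b c) := by
    intro a' b' c' d' h1 h2 h3 h4 h5 h6
    obtain ⟨σ, hσ⟩ := Equiv.Perm.exists_extending_pair ![a, b, c, d] ![a', b', c', d']
      (by intro i j; fin_cases i <;> fin_cases j <;> simp [*, Ne.symm, eq_comm])
      (by intro i j; fin_cases i <;> fin_cases j <;> simp [*, Ne.symm, eq_comm])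
    have ha : σ a = a' := hσ 0
    have hb : σ b = b' := hσ 1
    have hc : σ c = c' := hσ 2
    have hd : σ d = d' := hσ 3
    have conj : ∀ x y, ρ' (swap (σ x) (σ y)) = ρ' σ * ρ' (swap x y) * ρ' σ⁻¹ := by
      intro x y
      rw [← map_mul, ← map_mul, Equiv.mul_swap_eq_swap_mul, mul_assoc, mul_inv_cancel, mul_one]
    have : ρ' (swap a' c') + ρ' (swap b' d') - ρ' (swap a' d') - ρ' (swap b' c') = 0 := by
      rw [← ha, ← hb, ← hc, ← hd, conj, conj, conj, conj, ← add_mul, ← mul_add, ← sub_mul,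
        ← mul_sub, ← sub_mul, ← mul_sub, rel0, mul_zero, zero_mul]
    rw [sub_sub, sub_eq_zero] at this
    exact this
  rcases threeCycle_of_four_term (by rw [Nat.card_eq_fintype_card]; exact hcard) ρ'
    (fun T hT => schur T fun g _ => by rw [← hext]; exact hT g) hrel with h | ⟨h2, h⟩
  · exfalso
    refine absurd hdim (not_lt.2 (hirr.of_comp.rank_le_one_of_trivial fun g => ?_))
    have hle : alternatingGroup α ≤ (MonoidHom.ker (ρ' : Perm α →* Module.End F V)) := by
      rw [← closure_three_cycles_eq_alternating, Subgroup.closure_le]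
      intro s hs
      obtain ⟨a, b, c, hab, hac, hbc, rfl⟩ := IsThreeCycle.exists_eq_swap_mul_swap hs
      exact h a b c hab hac hbc
    rw [← hext]
    exact hle g.2
  · refine ⟨h2, fun s hs => ?_⟩
    obtain ⟨a, b, c, hab, hac, hbc, he⟩ := hs.exists_eq_swap_mul_swap
    rw [← hext, he]
    exact h a b c hab hac hbc

end Nonextendability

section Weights

open Module

variable {F V κ : Type*} [Field F] [AddCommGroup V] [Module F V] [Fintype κ] [DecidableEq κ]
  {p : ℕ} [Fact p.Prime]

/-- `ψ` is a weight of the action `E` of an elementary abelian `p`-group. -/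
def IsWeight (χ : AddChar (ZMod p) F) (E : AddChar (κ → ZMod p) (End F V)) (ψ : κ → ZMod p) :
    Prop :=
  ∃ v : V, v ≠ 0 ∧ ∀ a, E a v = χ (ψ ⬝ᵥ a) • v

/-- The projection onto the weight space of `ψ`. -/
noncomputable def weightProj (χ : AddChar (ZMod p) F) (E : AddChar (κ → ZMod p) (End F V))
    (ψ : κ → ZMod p) : End F V :=
  ((p : F) ^ Fintype.card κ)⁻¹ • ∑ a, χ (-(ψ ⬝ᵥ a)) • E a

theorem AddChar.IsPrimitive.sum_dotProduct {χ : AddChar (ZMod p) F} (hχ : χ.IsPrimitive)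
    (ψ : κ → ZMod p) :
    ∑ a : κ → ZMod p, χ (ψ ⬝ᵥ a) = if ψ = 0 then (p : F) ^ Fintype.card κ else 0 := by
  split_ifs with h
  · simp [h, ZMod.card]
  · obtain ⟨i, hi⟩ := Function.ne_iff.1 h
    obtain ⟨x, hx⟩ := AddChar.ne_one_iff.1 (hχ hi)
    rw [AddChar.mulShift_apply] at hx
    have key : χ (ψ i * x) * ∑ a : κ → ZMod p, χ (ψ ⬝ᵥ a) = ∑ a : κ → ZMod p, χ (ψ ⬝ᵥ a) := by
      rw [Finset.mul_sum, ← Equiv.sum_comp (Equiv.addLeft (Pi.single i x : κ → ZMod p))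
        (fun a => χ (ψ ⬝ᵥ a))]
      refine Finset.sum_congr rfl fun a _ => ?_
      rw [Equiv.coe_addLeft, dotProduct_add, dotProduct_single, AddChar.map_add_eq_mul]
    by_contra hne
    exact hx (mul_right_cancel₀ hne (key.trans (one_mul _).symm))

variable {χ : AddChar (ZMod p) F} {E : AddChar (κ → ZMod p) (End F V)}

theorem mul_weightProj (ψ b : κ → ZMod p) :
    E b * weightProj χ E ψ = χ (ψ ⬝ᵥ b) • weightProj χ E ψ := by
  rw [weightProj, mul_smul_comm, smul_comm (χ _)]
  congr 1
  rw [Finset.mul_sum, Finset.smul_sum,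
    ← Equiv.sum_comp (Equiv.addLeft b) (fun a => χ (ψ ⬝ᵥ b) • χ (-(ψ ⬝ᵥ a)) • E a)]
  refine Finset.sum_congr rfl fun a _ => ?_
  rw [Equiv.coe_addLeft, dotProduct_add, mul_smul_comm, ← AddChar.map_add_eq_mul, smul_smul,
    ← AddChar.map_add_eq_mul, neg_add, add_neg_cancel_left]

theorem Commute.weightProj {T : End F V} (hT : ∀ a, Commute T (E a)) (ψ : κ → ZMod p) :
    Commute T (weightProj χ E ψ) :=
  (Commute.sum_right _ _ _ fun a _ => (hT a).smul_right _).smul_right _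

theorem weightProj_apply_of_weight (hχ : χ.IsPrimitive) (hp : (p : F) ≠ 0) {φ ψ : κ → ZMod p}
    {v : V} (hv : ∀ a, E a v = χ (ψ ⬝ᵥ a) • v) :
    weightProj χ E φ v = if φ = ψ then v else 0 := by
  have h : ∑ a, (χ (-(φ ⬝ᵥ a)) • E a) v = (∑ a, χ ((ψ - φ) ⬝ᵥ a)) • v := by
    rw [Finset.sum_smul]
    refine Finset.sum_congr rfl fun a _ => ?_
    rw [LinearMap.smul_apply, hv, smul_smul, ← AddChar.map_add_eq_mul, sub_dotProduct,
      neg_add_eq_sub]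
  rw [_root_.weightProj, LinearMap.smul_apply, LinearMap.sum_apply, h, hχ.sum_dotProduct]
  by_cases hφ : φ = ψ
  · rw [if_pos (sub_eq_zero.2 hφ.symm), if_pos hφ, inv_smul_smul₀ (pow_ne_zero _ hp)]
  · rw [if_neg (sub_ne_zero.2 (Ne.symm hφ)), if_neg hφ, zero_smul, smul_zero]

theorem sum_weightProj (hχ : χ.IsPrimitive) (hp : (p : F) ≠ 0) :
    ∑ ψ, weightProj χ E ψ = 1 := by
  have h : ∀ a : κ → ZMod p, ∑ ψ : κ → ZMod p, χ (-(ψ ⬝ᵥ a)) • E a =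
      if a = 0 then (p : F) ^ Fintype.card κ • (1 : End F V) else 0 := by
    intro a
    have := hχ.sum_dotProduct (-a)
    simp_rw [dotProduct_comm (-a), dotProduct_neg, neg_eq_zero] at this
    rw [← Finset.sum_smul, this]
    split_ifs with h0
    · rw [h0, AddChar.map_zero_eq_one]
    · rw [zero_smul]
  simp_rw [weightProj]
  rw [← Finset.smul_sum, Finset.sum_comm]
  simp_rw [h]
  rw [Finset.sum_ite_eq' Finset.univ (0 : κ → ZMod p), if_pos (Finset.mem_univ _),
    inv_smul_smul₀ (pow_ne_zero _ hp)]

theorem isWeight_of_weightProj_apply_ne_zero {ψ : κ → ZMod p} {v : V}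
    (h : weightProj χ E ψ v ≠ 0) : IsWeight χ E ψ :=
  ⟨_, h, fun a => by rw [← LinearMap.smul_apply, ← mul_weightProj]; rfl⟩

theorem IsWeight.weightProj_ne_zero (hχ : χ.IsPrimitive) (hp : (p : F) ≠ 0) {ψ : κ → ZMod p}
    (h : IsWeight χ E ψ) : weightProj χ E ψ ≠ 0 := by
  obtain ⟨v, hv, hE⟩ := h
  intro h0
  have := weightProj_apply_of_weight hχ hp (φ := ψ) hE
  rw [h0, if_pos rfl] at this
  exact hv this.symm

theorem exists_isWeight_apply_ne_zero (hχ : χ.IsPrimitive) (hp : (p : F) ≠ 0) (T : End F V)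
    {v : V} (hv : T v ≠ 0) :
    ∃ ψ, IsWeight χ E ψ ∧ T (weightProj χ E ψ v) ≠ 0 := by
  by_contra! h
  refine hv ?_
  have h1 : T v = ∑ ψ, T (weightProj χ E ψ v) := by
    conv_lhs => rw [← Module.End.one_apply (R := F) v, ← sum_weightProj (E := E) hχ hp]
    rw [LinearMap.sum_apply, map_sum]
  rw [h1]
  refine Finset.sum_eq_zero fun ψ _ => ?_
  by_cases h0 : weightProj χ E ψ v = 0
  · rw [h0, map_zero]
  · exact h ψ (isWeight_of_weightProj_apply_ne_zero h0)

theorem card_le_finrank_of_isWeight [FiniteDimensional F V] (hχ : χ.IsPrimitive)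
    (hp : (p : F) ≠ 0) (s : Finset (κ → ZMod p)) (hs : ∀ ψ ∈ s, IsWeight χ E ψ) :
    s.card ≤ finrank F V := by
  choose! v hv hE using hs
  have hli : LinearIndependent F (fun ψ : s => v ψ) := by
    rw [Fintype.linearIndependent_iff]
    intro c hc ψ
    have h1 := congrArg (weightProj χ E ψ.1) hc
    rw [map_sum, map_zero, Finset.sum_eq_single ψ] at h1
    · rw [map_smul, weightProj_apply_of_weight hχ hp (hE _ ψ.2), if_pos rfl] at h1
      exact (smul_eq_zero.1 h1).resolve_right (hv _ ψ.2)
    · intro φ _ hφ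
      rw [map_smul, weightProj_apply_of_weight hχ hp (hE _ φ.2),
        if_neg fun h => hφ (Subtype.ext h.symm), smul_zero]
    · exact fun h => absurd (Finset.mem_univ _) h
  simpa using hli.fintype_card_le_finrank

end Weights

section BlockShifts

open Equiv Equiv.Perm

/-- The homomorphism from permutations of `β` to even permutations of a set containing `β` and two
further points, which are swapped by the image of an odd permutation. -/
noncomputable def evenExtension {α β : Type*} [DecidableEq α] [Fintype α] [DecidableEq β]
    [Fintype β] (ι : β ⊕ Bool ↪ α) : Perm β →* alternatingGroup α :=
  ((viaEmbeddingHom ι).comp ((sumCongrHom β Bool).comp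
    ((MonoidHom.id _).prod ((MulEquiv.ofBijective (sign : Perm Bool →* ℤˣ)
      (by decide)).symm.toMonoidHom.comp sign)))).codRestrict _ (by
    intro g
    rw [mem_alternatingGroup]
    have h := (MulEquiv.ofBijective (sign : Perm Bool →* ℤˣ) (by decide)).apply_symm_apply (sign g)
    rw [MulEquiv.ofBijective_apply] at h
    simp only [MonoidHom.comp_apply, viaEmbeddingHom_apply, viaEmbedding, sign_extendDomain]
    simp [h, Int.units_mul_self])

theorem evenExtension_apply_inl {α β : Type*} [DecidableEq α] [Fintype α] [DecidableEq β]
    [Fintype β] (ι : β ⊕ Bool ↪ α) (g : Perm β) (x : β) :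
    (evenExtension ι g : Perm α) (ι (Sum.inl x)) = ι (Sum.inl (g x)) := by
  simp [evenExtension, viaEmbeddingHom_apply, viaEmbedding_apply]

theorem evenExtension_apply_of_notMem {α β : Type*} [DecidableEq α] [Fintype α] [DecidableEq β]
    [Fintype β] (ι : β ⊕ Bool ↪ α) (g : Perm β) (hg : sign g = 1) {x : α}
    (hx : ∀ y, x ≠ ι (Sum.inl y)) : (evenExtension ι g : Perm α) x = x := by
  by_cases h : x ∈ Set.range ι
  · obtain ⟨y | b, rfl⟩ := h
    · exact absurd rfl (hx y)
    · simp [evenExtension, viaEmbeddingHom_apply, viaEmbedding_apply, hg]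
  · simp [evenExtension, viaEmbeddingHom_apply, viaEmbedding_apply_of_notMem _ _ _ h]

/-- Translation by `a i` in the `i`-th block of `κ × ZMod p`. -/
def blockShift (κ : Type*) (p : ℕ) : AddChar (κ → ZMod p) (Perm (κ × ZMod p)) where
  toFun a := (Equiv.refl κ).prodShear fun i => Equiv.addRight (a i)
  map_zero_eq_one' := by ext <;> simp
  map_add_eq_mul' a b := by ext x <;> simp [add_assoc, add_comm (a _)]

theorem blockShift_apply {κ : Type*} {p : ℕ} (a : κ → ZMod p) (x : κ × ZMod p) :
    blockShift κ p a x = (x.1, x.2 + a x.1) := rfl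

variable {κ : Type*} [Fintype κ] [DecidableEq κ] {p : ℕ} [Fact p.Prime]

theorem sign_blockShift (hp : p ≠ 2) (a : κ → ZMod p) : sign (blockShift κ p a) = 1 := by
  have h : sign (blockShift κ p a) ^ p = 1 := by
    rw [← map_pow, ← AddChar.map_nsmul_eq_pow]
    have : p • a = 0 := by ext i; simp
    rw [this, AddChar.map_zero_eq_one, map_one]
  have hodd := (Fact.out : p.Prime).odd_of_ne_two hp
  rcases Int.units_eq_one_or (sign (blockShift κ p a)) with h1 | h1
  · exact h1
  · rw [h1, hodd.neg_one_pow] at h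
    exact absurd h (by decide)

theorem blockShift_mul_prodShear {κ : Type*} (π : Perm κ) (u : κ → (ZMod p)ˣ) (a : κ → ZMod p) :
    blockShift κ p a * π.prodShear (fun i => (u i)⁻¹.mulLeft) =
      π.prodShear (fun i => (u i)⁻¹.mulLeft) * blockShift κ p (fun i => u i * a (π i)) := by
  refine Equiv.ext fun x => Prod.ext rfl ?_
  change (↑(u x.1)⁻¹ : ZMod p) * x.2 + a (π x.1) = ↑(u x.1)⁻¹ * (x.2 + u x.1 * a (π x.1))
  rw [mul_add, Units.inv_mul_cancel_left]

variable {F V α : Type*} [Field F] [AddCommGroup V] [Module F V] [DecidableEq α] [Fintype α]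

/-- The action of the block shifts on a representation of the alternating group. -/
noncomputable def shiftAction (ι : (κ × ZMod p) ⊕ Bool ↪ α)
    (ρ : Representation F (alternatingGroup α) V) : AddChar (κ → ZMod p) (Module.End F V) :=
  (ρ.comp (evenExtension ι)).compAddChar (blockShift κ p)

theorem shiftAction_apply (ι : (κ × ZMod p) ⊕ Bool ↪ α)
    (ρ : Representation F (alternatingGroup α) V) (a : κ → ZMod p) :
    shiftAction ι ρ a = ρ (evenExtension ι (blockShift κ p a)) := rfl

theorem IsWeight.of_card_support_eq {χ : AddChar (ZMod p) F} {ι : (κ × ZMod p) ⊕ Bool ↪ α}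
    {ρ : Representation F (alternatingGroup α) V} {ψ ψ' : κ → ZMod p}
    (h : IsWeight χ (shiftAction ι ρ) ψ)
    (hc : (Finset.univ.filter fun i => ψ i ≠ 0).card =
      (Finset.univ.filter fun i => ψ' i ≠ 0).card) :
    IsWeight χ (shiftAction ι ρ) ψ' := by
  have e : {i // ψ i ≠ 0} ≃ {i // ψ' i ≠ 0} := by
    refine Fintype.equivOfCardEq ?_
    rwa [Fintype.card_subtype, Fintype.card_subtype]
  obtain ⟨π, hπ, hπ'⟩ : ∃ π : Perm κ, (∀ i, ψ i ≠ 0 → ψ' (π i) ≠ 0) ∧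
      ∀ i, ψ i = 0 → ψ' (π i) = 0 :=
    ⟨e.extendSubtype, fun i hi => e.extendSubtype_mem i hi,
      fun i hi => not_not.1 (e.extendSubtype_not_mem i (not_not.2 hi))⟩
  obtain ⟨u, hu⟩ : ∃ u : κ → (ZMod p)ˣ, ∀ i, ψ' (π i) = ψ i * u i := by
    refine ⟨fun i => if hi : ψ i ≠ 0 then Units.mk0 (ψ' (π i) / ψ i)
      (div_ne_zero (hπ i hi) hi) else 1, fun i => ?_⟩
    by_cases hi : ψ i = 0
    · simp [hi, hπ' i hi]
    · simp [hi, mul_div_cancel₀]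
  obtain ⟨v, hv, hE⟩ := h
  set s := evenExtension ι (π.prodShear fun i => (u i)⁻¹.mulLeft) with hs
  refine ⟨ρ s v, fun h0 => hv ?_, fun a => ?_⟩
  · have := congrArg (ρ s⁻¹) h0
    rwa [← Module.End.mul_apply, ← map_mul, inv_mul_cancel, map_one, map_zero] at this
  · rw [shiftAction_apply, ← Module.End.mul_apply, ← map_mul, hs, ← map_mul,
      blockShift_mul_prodShear, map_mul, map_mul, Module.End.mul_apply, ← shiftAction_apply, hE,
      map_smul]
    congr 2
    rw [dotProduct, dotProduct, ← Equiv.sum_comp π (fun i => ψ' i * a i)]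
    refine Finset.sum_congr rfl fun i _ => ?_
    rw [hu, mul_assoc]

theorem Nat.two_pow_le_choose_add {j d : ℕ} (h : d ≤ j) : 2 ^ d ≤ (j + d).choose d := by
  induction d with
  | zero => simp
  | succ d ih =>
    have h1 := Nat.add_one_mul_choose_eq (j + d) d
    have h2 := ih (by omega)
    refine Nat.le_of_mul_le_mul_right (c := d + 1) ?_ (by omega)
    rw [← add_assoc, ← h1, pow_succ]
    nlinarith

theorem card_filter_card_support_eq (j : ℕ) :
    (Finset.univ.filter fun ψ : κ → ZMod p =>
      (Finset.univ.filter fun i => ψ i ≠ 0).card = j).card =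
      (Fintype.card κ).choose j * (p - 1) ^ j := by
  rw [Finset.card_eq_sum_card_fiberwise
    (f := fun ψ : κ → ZMod p => Finset.univ.filter fun i => ψ i ≠ 0)
    (t := Finset.powersetCard j Finset.univ)]
  · rw [Finset.sum_const_nat (m := (p - 1) ^ j), Finset.card_powersetCard, Finset.card_univ]
    intro I hI
    have hI' := (Finset.mem_powersetCard.1 hI).2
    have : (Finset.univ.filter fun ψ : κ → ZMod p =>
        (Finset.univ.filter fun i => ψ i ≠ 0).card = j).filter
          (fun ψ => (Finset.univ.filter fun i => ψ i ≠ 0) = I) =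
        Fintype.piFinset fun i => if i ∈ I then Finset.univ.erase (0 : ZMod p) else {0} := by
      ext ψ
      simp only [Finset.mem_filter, Finset.mem_univ, true_and, Fintype.mem_piFinset]
      constructor
      · rintro ⟨-, rfl⟩ i
        by_cases hi : ψ i = 0 <;> simp [hi]
      · intro h
        have : (Finset.univ.filter fun i => ψ i ≠ 0) = I := by
          ext i
          have := h i
          split_ifs at this with hi
          · simpa [hi] using this
          · simpa [hi] using this
        exact ⟨this ▸ hI', this⟩
    rw [this, Fintype.card_piFinset, Finset.prod_apply_ite]
    simp [hI', ZMod.card]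
  · intro ψ hψ
    have := (Finset.mem_filter.1 (Finset.mem_coe.1 hψ)).2
    exact Finset.mem_coe.2 (Finset.mem_powersetCard.2 ⟨Finset.subset_univ _, this⟩)

theorem IsWeight.pow_le_finrank_sq [FiniteDimensional F V] {χ : AddChar (ZMod p) F}
    (hχ : χ.IsPrimitive) (hp : p ≠ 2) (hpF : (p : F) ≠ 0) {ι : (κ × ZMod p) ⊕ Bool ↪ α}
    {ρ : Representation F (alternatingGroup α) V} {ψ : κ → ZMod p}
    (h : IsWeight χ (shiftAction ι ρ) ψ)
    (hc : Fintype.card κ ≤ 2 * (Finset.univ.filter fun i => ψ i ≠ 0).card) :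
    (2 * (p - 1)) ^ Fintype.card κ ≤ Module.finrank F V ^ 2 := by
  have h1 := card_le_finrank_of_isWeight hχ hpF
    (Finset.univ.filter fun ψ' : κ → ZMod p => (Finset.univ.filter fun i => ψ' i ≠ 0).card =
      (Finset.univ.filter fun i => ψ i ≠ 0).card)
    fun ψ' hψ' => h.of_card_support_eq (Finset.mem_filter.1 hψ').2.symm
  rw [card_filter_card_support_eq] at h1
  have hjk : (Finset.univ.filter fun i => ψ i ≠ 0).card ≤ Fintype.card κ := Finset.card_le_univ _
  generalize (Finset.univ.filter fun i => ψ i ≠ 0).card = j at hc h1 hjk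
  have hp2 := (Fact.out : p.Prime).two_le
  obtain ⟨q, rfl⟩ : ∃ q, p = q + 3 := ⟨p - 3, by omega⟩
  obtain ⟨d, hd⟩ := Nat.exists_eq_add_of_le hjk
  have hdj : d ≤ j := by omega
  obtain ⟨e, rfl⟩ := Nat.exists_eq_add_of_le hdj
  have h2 := Nat.two_pow_le_choose_add hdj
  rw [← Nat.choose_symm_add, ← hd] at h2
  refine le_trans ?_ (Nat.pow_le_pow_left h1 2)
  rw [hd] at h2 ⊢
  calc (2 * (q + 3 - 1)) ^ (d + e + d) = 2 ^ (2 * d) * (q + 2) ^ (2 * d + e) * 2 ^ e := by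
        rw [show q + 3 - 1 = q + 2 by omega, mul_pow]; ring
    _ ≤ 2 ^ (2 * d) * (q + 2) ^ (2 * d + e) * (q + 2) ^ e := by gcongr; omega
    _ = (2 ^ d * (q + 2) ^ (d + e)) ^ 2 := by ring
    _ ≤ _ := by
        rw [show q + 3 - 1 = q + 2 by omega]; gcongr

end BlockShifts

section WeightDichotomy

open Equiv Equiv.Perm

theorem alternatingGroup.exists_ofSubtype_eq {α : Type*} [DecidableEq α] [Fintype α]
    {s : Finset α} {g : alternatingGroup α} (hg : ∀ x, x ∉ s → (g : Perm α) x = x) :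
    ∃ h, alternatingGroup.ofSubtype s h = g := by
  have h2 : ∀ x, (g : Perm α) x ≠ x → x ∈ s := fun x hx => by_contra fun h => hx (hg x h)
  have h1 : ∀ x, (g : Perm α) x ∈ s ↔ x ∈ s := by
    intro x
    by_cases hx : (g : Perm α) x = x
    · rw [hx]
    · exact iff_of_true (h2 _ fun h => hx ((g : Perm α).injective h)) (h2 x hx)
  refine ⟨⟨(g : Perm α).subtypePerm h1, ?_⟩, ?_⟩
  · rw [mem_alternatingGroup]
    convert (sign_subtypePerm _ h1 h2).trans (mem_alternatingGroup.1 g.2)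
  · apply Subtype.ext
    rw [coe_ofSubtype]
    exact ofSubtype_subtypePerm h1 h2

variable {κ : Type*} [Fintype κ] [DecidableEq κ] {p : ℕ} [Fact p.Prime]
  {F V α : Type*} [Field F] [AddCommGroup V] [Module F V] [DecidableEq α] [Fintype α]

/-- A projection commuting with the pointwise stabilizer of `sᶜ` in the alternating group and
absorbing one of its nontrivial elements absorbs all of them. -/
theorem mul_eq_self_of_commute (ρ : Representation F (alternatingGroup α) V) {Q : Module.End F V}
    {s : Finset α} (hs : 5 ≤ s.card)
    (hcomm : ∀ g : alternatingGroup α, (∀ x, x ∉ s → (g : Perm α) x = x) → Commute (ρ g) Q)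
    {c : alternatingGroup α} (hc : ∀ x, x ∉ s → (c : Perm α) x = x) (hc1 : c ≠ 1)
    (hcQ : ρ c * Q = Q) {g : alternatingGroup α} (hg : ∀ x, x ∉ s → (g : Perm α) x = x) :
    ρ g * Q = Q := by
  have hfix : ∀ h : alternatingGroup s, ∀ x, x ∉ s →
      (alternatingGroup.ofSubtype s h : Perm α) x = x := by
    intro h x hx
    rw [alternatingGroup.coe_ofSubtype, ofSubtype_apply_of_not_mem _ hx]
  let K : Subgroup (alternatingGroup s) :=
    { carrier := {h | ρ (alternatingGroup.ofSubtype s h) * Q = Q}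
      mul_mem' := fun {a b} (ha : _ = _) (hb : _ = _) => by
        change _ = _
        rw [map_mul, map_mul, mul_assoc, hb, ha]
      one_mem' := by change _ = _; rw [map_one, map_one, one_mul]
      inv_mem' := fun {a} (ha : _ = _) => by
        change _ = _
        conv_lhs => rw [← ha, ← mul_assoc, ← map_mul, ← map_mul, inv_mul_cancel, map_one, map_one,
          one_mul] }
  have hK : K.Normal := by
    refine ⟨fun a (ha : _ = _) b => ?_⟩
    change _ = _
    rw [map_mul, map_mul, map_mul, map_mul, mul_assoc, (hcomm _ (hfix _)).eq, ← mul_assoc,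
      mul_assoc _ _ Q, ha, (hcomm _ (hfix _)).eq, mul_assoc, ← map_mul, ← map_mul, mul_inv_cancel,
      map_one, map_one, mul_one]
  obtain ⟨c', rfl⟩ := alternatingGroup.exists_ofSubtype_eq hc
  obtain ⟨g', rfl⟩ := alternatingGroup.exists_ofSubtype_eq hg
  have : IsSimpleGroup (alternatingGroup s) :=
    alternatingGroup.isSimpleGroup (by rwa [Nat.card_eq_fintype_card, Fintype.card_coe])
  rcases hK.eq_bot_or_eq_top with h | h
  · have : c' ∈ K := hcQ
    rw [h, Subgroup.mem_bot] at this
    exact absurd (by rw [this, map_one]) hc1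
  · exact (h ▸ Subgroup.mem_top g' : g' ∈ K)

/-- Either the block shifts have a weight of large support or the representation extends to the
symmetric group. -/
theorem exists_isWeight_or_exists_extension {χ : AddChar (ZMod p) F} (hχ : χ.IsPrimitive)
    (hp : p ≠ 2) (hpF : (p : F) ≠ 0) (ι : (κ × ZMod p) ⊕ Bool ↪ α)
    (ρ : Representation F (alternatingGroup α) V) (hirr : RepIrreducible ρ) :
    (∃ ψ, IsWeight χ (shiftAction ι ρ) ψ ∧
      Fintype.card κ ≤ 2 * (Finset.univ.filter fun i => ψ i ≠ 0).card) ∨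
      ∃ ρ' : Representation F (Perm α) V, ∀ g : alternatingGroup α, ρ' g = ρ g := by
  rw [or_iff_not_imp_left]
  intro hsmall
  push Not at hsmall
  have hp3 : 3 ≤ p := by
    have := (Fact.out : p.Prime).two_le
    omega
  have := hirr.1
  set E := shiftAction ι ρ with hEdef
  obtain ⟨ψ, hψ, hmax⟩ : ∃ ψ, IsWeight χ E ψ ∧ ∀ φ, IsWeight χ E φ →
      (Finset.univ.filter fun i => φ i ≠ 0).card ≤ (Finset.univ.filter fun i => ψ i ≠ 0).card := by
    obtain ⟨v, hv⟩ := exists_ne (0 : V)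
    obtain ⟨ψ₀, hψ₀, -⟩ := exists_isWeight_apply_ne_zero (E := E) hχ hpF 1 hv
    obtain ⟨ψ, hψ, hm⟩ := Set.exists_max_image {ψ | IsWeight χ E ψ}
      (fun φ => (Finset.univ.filter fun i => φ i ≠ 0).card) (Set.toFinite _) ⟨ψ₀, hψ₀⟩
    exact ⟨ψ, hψ, hm⟩
  have hlt := hsmall ψ hψ
  let restr : (κ → ZMod p) →+ (κ → ZMod p) :=
    { toFun := fun a i => if ψ i ≠ 0 then a i else 0
      map_zero' := by ext i; simp
      map_add' := fun a b => by
        ext i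
        by_cases h : ψ i = 0 <;> simp [h] }
  have restr_apply : ∀ a i, restr a i = if ψ i ≠ 0 then a i else 0 := fun _ _ => rfl
  have dot_restr : ∀ a, ψ ⬝ᵥ restr a = ψ ⬝ᵥ a := by
    intro a
    refine Finset.sum_congr rfl fun i _ => ?_
    rw [restr_apply]
    by_cases h : ψ i = 0 <;> simp [h]
  set E' := E.compAddMonoidHom restr with hE'
  set Q := weightProj χ E' ψ with hQdef
  have hQ : Q ≠ 0 := by
    refine IsWeight.weightProj_ne_zero hχ hpF ?_
    obtain ⟨v, hv, hEv⟩ := hψ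
    exact ⟨v, hv, fun a => by rw [hE', AddChar.compAddMonoidHom_apply, hEv, dot_restr]⟩
  have hcommE : ∀ a b, Commute (E a) (E' b) := fun a b => by
    rw [hE', AddChar.compAddMonoidHom_apply, commute_iff_eq, ← AddChar.map_add_eq_mul,
      ← AddChar.map_add_eq_mul, add_comm]
  have hEQ : ∀ i, ψ i = 0 → ∀ c, E (Pi.single i c) * Q = Q := by
    intro i hi c
    rw [← sub_eq_zero, ← sub_one_mul]
    by_contra hne
    obtain ⟨v, hv⟩ := DFunLike.ne_iff.1 hne
    rw [Module.End.mul_apply, LinearMap.zero_apply] at hv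
    obtain ⟨φ, hφ, h0⟩ := exists_isWeight_apply_ne_zero (E := E) hχ hpF _ hv
    set w := weightProj χ E φ (Q v) with hw
    have hw0 : w ≠ 0 := by
      rintro h
      rw [h, map_zero] at h0
      exact h0 rfl
    have hEw : ∀ a, E a w = χ (φ ⬝ᵥ a) • w := fun a => by
      rw [hw, ← Module.End.mul_apply, mul_weightProj]; rfl
    have hE'w : ∀ a, E' a w = χ (ψ ⬝ᵥ a) • w := fun a => by
      have h1 : Commute (E' a) (weightProj χ E φ) :=
        Commute.weightProj (fun b => (hcommE b a).symm) φ
      rw [hw, ← Module.End.mul_apply, h1.eq, Module.End.mul_apply, ← Module.End.mul_apply _ Q,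
        mul_weightProj, LinearMap.smul_apply, map_smul]
    have hφψ : ∀ j, ψ j ≠ 0 → φ j = ψ j := by
      intro j hj
      refine AddChar.to_mulShift_inj_of_isPrimitive hχ (AddChar.ext _ _ fun x => ?_)
      rw [AddChar.mulShift_apply, AddChar.mulShift_apply]
      have h1 := hE'w (Pi.single j x)
      have h2 : restr (Pi.single j x) = Pi.single j x := by
        ext i
        rw [restr_apply]
        by_cases hij : i = j
        · rw [if_pos (hij ▸ hj)]
        · rw [Pi.single_eq_of_ne hij, ite_self]
      rw [hE', AddChar.compAddMonoidHom_apply, h2, hEw, dotProduct_single, dotProduct_single] at h1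
      exact smul_left_injective F hw0 h1
    have hφi : φ i = 0 := by
      by_contra hφi
      refine (Finset.card_lt_card ?_).not_ge (hmax φ hφ)
      refine Finset.ssubset_iff_subset_ne.2 ⟨fun j hj => ?_, fun h => ?_⟩
      · rw [Finset.mem_filter] at hj ⊢
        exact ⟨hj.1, by rw [hφψ j hj.2]; exact hj.2⟩
      · have : i ∈ Finset.univ.filter fun i => φ i ≠ 0 := by simpa using hφi
        rw [← h] at this
        exact (Finset.mem_filter.1 this).2 hi
    apply h0
    rw [LinearMap.sub_apply, hEw, dotProduct_single, hφi, zero_mul, AddChar.map_zero_eq_one,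
      one_smul, Module.End.one_apply, sub_self]
  let Δ : Finset α := ((Finset.univ.filter fun i => ψ i ≠ 0) ×ˢ (Finset.univ : Finset (ZMod p))).map
    (Function.Embedding.inl.trans ι)
  have mem_Δ : ∀ y, y ∈ Δ ↔ ∃ i x, ψ i ≠ 0 ∧ ι (Sum.inl (i, x)) = y := by
    intro y
    simp [Δ]
  have hcardα : Fintype.card κ * p + 2 ≤ Fintype.card α := by
    have := Fintype.card_le_of_embedding ι
    simpa [ZMod.card] using this
  have hΔcard : Δ.card = (Finset.univ.filter fun i => ψ i ≠ 0).card * p := by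
    simp [Δ, ZMod.card]
  have hbound : 2 * Δ.card + p + 2 ≤ Fintype.card α := by
    rw [hΔcard]
    nlinarith
  have hcomm : ∀ g : alternatingGroup α, (∀ x, x ∉ Δᶜ → (g : Perm α) x = x) →
      Commute (ρ g) Q := by
    intro g hg
    refine Commute.weightProj (fun a => ?_) ψ
    rw [hE', AddChar.compAddMonoidHom_apply, hEdef, shiftAction_apply]
    refine Commute.map (?_ : Commute g _) ρ
    refine Subtype.ext (Disjoint.commute fun y => ?_).eq
    by_cases hy : y ∈ Δ
    · exact Or.inl (hg y (by simpa using hy))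
    · right
      by_cases hyι : ∃ z, y = ι (Sum.inl z)
      · obtain ⟨z, rfl⟩ := hyι
        have hz : ψ z.1 = 0 := by
          by_contra h
          exact hy ((mem_Δ _).2 ⟨z.1, z.2, h, rfl⟩)
        rw [evenExtension_apply_inl, blockShift_apply, restr_apply, if_neg (not_not.2 hz), add_zero]
      · push Not at hyι
        exact evenExtension_apply_of_notMem ι _ (sign_blockShift hp _) hyι
  obtain ⟨i, hi⟩ : ∃ i, ψ i = 0 := by
    by_contra! h
    rw [Finset.filter_true_of_mem fun i _ => h i, Finset.card_univ] at hlt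
    omega
  have hcΔ : 5 ≤ Δᶜ.card := by
    have := Finset.card_add_card_compl Δ
    omega
  set c := evenExtension ι (blockShift κ p (Pi.single i 1)) with hc
  have hc1 : c ≠ 1 := by
    intro h
    have h1 := evenExtension_apply_inl ι (blockShift κ p (Pi.single i 1)) (i, 0)
    rw [← hc, h, blockShift_apply] at h1
    have h2 := ι.injective h1
    simp at h2
  have hcfix : ∀ x, x ∉ Δᶜ → (c : Perm α) x = x := by
    intro x hx
    rw [Finset.mem_compl, not_not, mem_Δ] at hx
    obtain ⟨j, y, hj, rfl⟩ := hx
    have hji : j ≠ i := fun h => hj (h ▸ hi)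
    rw [hc, evenExtension_apply_inl, blockShift_apply]
    simp [hji]
  have hcQ : ρ c * Q = Q := hEQ i hi 1
  refine exists_extension_of_biinvariant ρ hirr Q hQ Δ (by omega) ?_
  rintro g ⟨x, y, z, w, hx, hy, hz, hw, hg⟩
  have hfix : ∀ t, t ∉ Δᶜ → (g : Perm α) t = t := by
    intro t ht
    rw [Finset.mem_compl, not_not] at ht
    have hne : ∀ u, u ∉ Δ → t ≠ u := fun u hu h => hu (h ▸ ht)
    rw [hg, Perm.mul_apply, swap_apply_of_ne_of_ne (hne z hz) (hne w hw),
      swap_apply_of_ne_of_ne (hne x hx) (hne y hy)]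
  have hgQ := mul_eq_self_of_commute ρ hcΔ hcomm hcfix hc1 hcQ hfix
  exact ⟨hgQ, (hcomm g hfix).eq ▸ hgQ⟩

end WeightDichotomy

section DegreeBound

open Equiv Equiv.Perm

theorem isThreeCycle_evenExtension_blockShift {κ α : Type*} [Fintype κ] [DecidableEq κ]
    [DecidableEq α] [Fintype α] (ι : (κ × ZMod 3) ⊕ Bool ↪ α) (i : κ) :
    (evenExtension ι (blockShift κ 3 (Pi.single i 1)) : Perm α).IsThreeCycle := by
  have := Nat.fact_prime_three
  rw [← card_support_eq_three_iff]
  have h : (evenExtension ι (blockShift κ 3 (Pi.single i 1)) : Perm α).support =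
      Finset.univ.map ⟨fun x : ZMod 3 => ι (Sum.inl (i, x)), fun x y h => by
        simpa using ι.injective h⟩ := by
    ext y
    rw [mem_support, Finset.mem_map]
    constructor
    · intro hy
      by_cases h : ∃ z, y = ι (Sum.inl z)
      · obtain ⟨⟨j, x⟩, rfl⟩ := h
        by_cases hj : j = i
        · exact ⟨x, Finset.mem_univ _, by rw [hj]; rfl⟩
        · rw [evenExtension_apply_inl, blockShift_apply] at hy
          simp [hj] at hy
      · push Not at h
        exact absurd (evenExtension_apply_of_notMem ι _ (sign_blockShift (by norm_num) _) h) hy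
    · rintro ⟨x, -, rfl⟩
      change (evenExtension ι _ : Perm α) (ι (Sum.inl (i, x))) ≠ ι (Sum.inl (i, x))
      rw [evenExtension_apply_inl, blockShift_apply, ι.injective.ne_iff, Sum.inl_injective.ne_iff]
      simp
  rw [h, Finset.card_map, Finset.card_univ, ZMod.card]

variable {F V α : Type*} [Field F] [IsAlgClosed F] [AddCommGroup V] [Module F V] [DecidableEq α]
  [Fintype α]

theorem pow_le_finrank_sq_of_irreducible_restriction {p k : ℕ} (hp : p.Prime) (hp2 : p ≠ 2)
    (hpF : (p : F) ≠ 0) (hp3 : p = 3 ∨ (2 : F) ≠ 0) (hk : k * p + 2 ≤ Fintype.card α)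
    (hcard : 9 ≤ Fintype.card α) (X : Subgroup (alternatingGroup α))
    (hprim : IsPrimitiveAction X α)
    (hpairs : ∃ x y z w : α, x ≠ y ∧ z ≠ w ∧ ∀ g ∈ X, s(g • x, g • y) ≠ s(z, w))
    (ρ : Representation F (alternatingGroup α) V) (hdim : 1 < Module.rank F V)
    (hirr : RepIrreducible (ρ.comp X.subtype)) :
    (2 * (p - 1)) ^ k ≤ Module.finrank F V ^ 2 := by
  have := Fact.mk hp
  have : NeZero (p : F) := ⟨hpF⟩
  have hirr' : RepIrreducible ρ := hirr.of_comp
  have : FiniteDimensional F V := hirr'.finiteDimensional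
  obtain ⟨ζ, hζ⟩ := HasEnoughRootsOfUnity.exists_primitiveRoot F p
  have hχ := AddChar.zmodChar_primitive_of_primitive_root p hζ
  set χ := AddChar.zmodChar p ((IsPrimitiveRoot.iff_def ζ p).mp hζ).left
  obtain ⟨ι⟩ : Nonempty ((Fin k × ZMod p) ⊕ Bool ↪ α) := by
    refine Function.Embedding.nonempty_of_card_le ?_
    simpa [ZMod.card] using hk
  suffices h : ∃ ψ, IsWeight χ (shiftAction ι ρ) ψ ∧
      Fintype.card (Fin k) ≤ 2 * (Finset.univ.filter fun i => ψ i ≠ 0).card by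
    obtain ⟨ψ, hψ, hc⟩ := h
    simpa using hψ.pow_le_finrank_sq hχ hp2 hpF hc
  rcases exists_isWeight_or_exists_extension hχ hp2 hpF ι ρ hirr' with h | ⟨ρ', hext⟩
  · exact h
  obtain ⟨h2, hcycle⟩ := two_eq_zero_of_extension hcard X hprim hpairs ρ hdim hirr ρ' hext
  obtain rfl := hp3.resolve_right (not_not.2 h2)
  have := hirr'.1
  obtain ⟨v, hv⟩ := exists_ne (0 : V)
  obtain ⟨ψ, hψ, -⟩ := exists_isWeight_apply_ne_zero (E := shiftAction ι ρ) hχ hpF 1 hv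
  refine ⟨ψ, hψ, ?_⟩
  rw [Finset.filter_true_of_mem, Finset.card_univ]
  · omega
  · intro i _ hi
    obtain ⟨w, hw, hE⟩ := hψ
    have h1 := hE (Pi.single i 1)
    rw [dotProduct_single, hi, zero_mul, AddChar.map_zero_eq_one, one_smul,
      shiftAction_apply] at h1
    have h3 := LinearMap.congr_fun (hcycle _ (isThreeCycle_evenExtension_blockShift ι i)) w
    rw [LinearMap.add_apply, LinearMap.add_apply, pow_two, Module.End.mul_apply, h1, h1,
      Module.End.one_apply, LinearMap.zero_apply, ← two_smul F, h2, zero_smul, zero_add] at h3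
    exact hw h3

end DegreeBound

section Bochert

open Equiv Equiv.Perm

/-- The commutator of two permutations whose supports meet in a single point is a 3-cycle. -/
theorem isThreeCycle_commutator {α : Type*} [DecidableEq α] [Fintype α] {g h : Perm α} {x : α}
    (hg : g x ≠ x) (hh : h x ≠ x) (H : ∀ y, g y ≠ y → h y ≠ y → y = x) :
    (g * h * g⁻¹ * h⁻¹).IsThreeCycle := by
  have hgh : h (g x) = g x := by
    by_contra hne
    exact hg (H _ (fun h' => hg (g.injective h')) hne)
  have hhg : g (h x) = h x := by
    by_contra hne
    exact hh (H _ hne (fun h' => hh (h.injective h')))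
  have h1 : g x ≠ h x := by
    intro he
    rw [← he] at hhg
    exact hg (g.injective hhg)
  suffices g * h = swap x (h x) * swap x (g x) * (h * g) by
    rw [mul_assoc, ← mul_inv_rev, this, mul_inv_cancel_right]
    exact isThreeCycle_swap_mul_swap_same hh.symm hg.symm h1.symm
  ext y
  simp only [Perm.mul_apply]
  by_cases hy : y = x
  · rw [hy, hgh, swap_apply_right, swap_apply_left, hhg]
  by_cases h2 : g y = y
  · rw [h2]
    by_cases h3 : h y = x
    · rw [h3, swap_apply_left, swap_apply_of_ne_of_ne hg h1]
    · have h4 : h y ≠ h x := fun h' => hy (h.injective h')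
      by_cases h5 : h y = y
      · have h6 : y ≠ g x := fun h' => hy (g.injective (h2.trans h'))
        rw [h5, h2, swap_apply_of_ne_of_ne hy h6, swap_apply_of_ne_of_ne hy (h5 ▸ h4)]
      · have h6 : h y ≠ g x := fun h' => by
          rw [← hgh] at h'
          exact h5 ((h.injective h').symm ▸ hgh)
        have h7 : g (h y) = h y := by
          by_contra h7
          exact h3 (H _ h7 fun h' => h5 (h.injective h'))
        rw [h7, swap_apply_of_ne_of_ne h3 h6, swap_apply_of_ne_of_ne h3 h4]
  · have h3 : h y = y := by
      by_contra h3
      exact hy (H y h2 h3)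
    rw [h3]
    by_cases h4 : g y = x
    · rw [h4, swap_apply_of_ne_of_ne hh h1.symm, swap_apply_right]
    · have h5 : h (g y) = g y := by
        by_contra h5
        exact h4 (H _ (fun h' => h2 (g.injective h')) h5)
      have h6 : g y ≠ g x := fun h' => hy (g.injective h')
      have h7 : g y ≠ h x := fun h' => by
        rw [← h5] at h'
        exact h4 (h.injective h')
      rw [h5, swap_apply_of_ne_of_ne h4 h6, swap_apply_of_ne_of_ne h4 h7]

/-- Bochert's bound for subgroups of the alternating group without 3-cycles. -/
theorem factorial_le_two_mul_index {α : Type*} [DecidableEq α] [Fintype α]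
    (hα : 3 ≤ Fintype.card α) (H : Subgroup (alternatingGroup α))
    (h3 : ∀ g ∈ H, ¬ (g : Perm α).IsThreeCycle) :
    ((Fintype.card α + 1) / 2).factorial ≤ 2 * H.index := by
  obtain ⟨Δ, hΔ, hmin⟩ : ∃ Δ : Finset α, (∀ g ∈ H, (∀ x ∈ Δ, (g : Perm α) x = x) → g = 1) ∧
      ∀ Δ' : Finset α, (∀ g ∈ H, (∀ x ∈ Δ', (g : Perm α) x = x) → g = 1) →
        Δ.card ≤ Δ'.card := by
    obtain ⟨Δ, hΔ, h⟩ := Set.exists_min_image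
      {Δ : Finset α | ∀ g ∈ H, (∀ x ∈ Δ, (g : Perm α) x = x) → g = 1} Finset.card
      (Set.toFinite _) ⟨Finset.univ, fun g _ hx => Subtype.ext (Equiv.ext fun y =>
        hx y (Finset.mem_univ y))⟩
    exact ⟨Δ, hΔ, h⟩
  have hcard := Finset.card_add_card_compl Δ
  by_cases hle : Δ.card ≤ Δᶜ.card
  · have hnt : Nontrivial (Δᶜ : Finset α) := by
      rw [← Fintype.one_lt_card_iff_nontrivial, Fintype.card_coe]
      omega
    have hinf : H ⊓ (alternatingGroup.ofSubtype Δᶜ).range = ⊥ := by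
      rw [eq_bot_iff]
      rintro _ ⟨hg, h, rfl⟩
      refine hΔ _ hg fun x hx => ?_
      rw [alternatingGroup.coe_ofSubtype, ofSubtype_apply_of_not_mem _ (by simpa using hx)]
    have h1 : Nat.card (alternatingGroup.ofSubtype Δᶜ).range ≤ H.index := by
      rw [← Subgroup.relIndex_bot_left, ← hinf, Subgroup.inf_relIndex_right,
        ← Subgroup.relIndex_top_right]
      exact Subgroup.relIndex_le_of_le_right le_top (Subgroup.FiniteIndex.index_ne_zero ∘
        (Subgroup.relIndex_top_right H).symm.trans)
    rw [← Nat.card_congr (MonoidHom.ofInjective alternatingGroup.ofSubtype_injective).toEquiv] at h1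
    have h2 := two_mul_nat_card_alternatingGroup (α := (Δᶜ : Finset α))
    rw [Nat.card_eq_fintype_card (α := Perm _), Fintype.card_perm, Fintype.card_coe] at h2
    refine (Nat.factorial_le (by omega : _ ≤ Δᶜ.card)).trans ?_
    omega
  · exfalso
    push Not at hle
    obtain ⟨g, hg, hfix, hg1⟩ : ∃ g ∈ H, (∀ x ∈ Δᶜ, (g : Perm α) x = x) ∧ g ≠ 1 := by
      by_contra! h
      exact hle.not_ge (hmin _ h)
    obtain ⟨x, hx⟩ : ∃ x, (g : Perm α) x ≠ x := by
      by_contra! h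
      exact hg1 (Subtype.ext (Equiv.ext h))
    have hxΔ : x ∈ Δ := by
      by_contra h
      exact hx (hfix x (Finset.mem_compl.2 h))
    obtain ⟨h, hh, hfix', hh1⟩ : ∃ h ∈ H, (∀ y ∈ Δ.erase x, (h : Perm α) y = y) ∧ h ≠ 1 := by
      by_contra! h
      exact (Finset.card_erase_lt_of_mem hxΔ).not_ge (hmin _ h)
    have hhx : (h : Perm α) x ≠ x := by
      intro hhx
      refine hh1 (hΔ h hh fun y hy => ?_)
      by_cases hyx : y = x
      · rw [hyx, hhx]
      · exact hfix' y (Finset.mem_erase.2 ⟨hyx, hy⟩)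
    refine h3 (g * h * g⁻¹ * h⁻¹) (H.mul_mem (H.mul_mem (H.mul_mem hg hh) (H.inv_mem hg))
      (H.inv_mem hh)) (isThreeCycle_commutator hx hhx fun y hgy hhy => ?_)
    by_contra hyx
    have hyΔ : y ∈ Δ := by
      by_contra h
      exact hgy (hfix y (Finset.mem_compl.2 h))
    exact hhy (hfix' y (Finset.mem_erase.2 ⟨hyx, hyΔ⟩))

end Bochert

section MaximalSubgroups

open Equiv Equiv.Perm Pointwise

variable {α : Type*} [DecidableEq α] [Fintype α]

theorem not_isThreeCycle_of_isPreprimitive {H : Subgroup (alternatingGroup α)} (hH : H ≠ ⊤)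
    (hprim : MulAction.IsPreprimitive H α) {g : alternatingGroup α} (hg : g ∈ H) :
    ¬ (g : Perm α).IsThreeCycle := by
  intro hg3
  apply hH
  rw [eq_top_iff, ← Subgroup.map_subtype_le_map_subtype,
    ← MonoidHom.range_eq_map, Subgroup.range_subtype]
  refine alternatingGroup_le_of_isPreprimitive_of_isThreeCycle_mem ?_ hg3 ⟨g, hg, rfl⟩
  let φ := (alternatingGroup α).subtype.subgroupMap H
  let f : α →ₑ[φ] α := {
      toFun := id
      map_smul' _ _ := rfl }
  rwa [← MulAction.isPreprimitive_congr (f := f)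
    ((alternatingGroup α).subtype.subgroupMap_surjective H) Function.bijective_id]

theorem index_eq_of_fixed_point {H : Subgroup (alternatingGroup α)} (hH : IsCoatom H)
    (hα : 3 ≤ Fintype.card α) {a : α} (ha : ∀ h ∈ H, h • a = a) :
    H.index = Fintype.card α := by
  have htrans : MulAction.IsPretransitive (alternatingGroup α) α :=
    alternatingGroup.isPretransitive_of_three_le_card α (by rwa [Nat.card_eq_fintype_card])
  have hidx := MulAction.index_stabilizer_of_transitive (alternatingGroup α) a
  rw [Nat.card_eq_fintype_card] at hidx
  have hle : H ≤ MulAction.stabilizer (alternatingGroup α) a := ha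
  rcases hH.le_iff.1 hle with h | h
  · rw [h, Subgroup.index_top] at hidx
    omega
  · rw [← h, hidx]

/-- A maximal subgroup of the alternating group other than a point stabilizer is primitive, or
fixes a set of size between `2` and `m - 2`, or is transitive and imprimitive. -/
theorem maximal_subgroup_trichotomy {H : Subgroup (alternatingGroup α)} (hH : IsCoatom H)
    (hα : 3 ≤ Fintype.card α) (hidx : H.index ≠ Fintype.card α) :
    MulAction.IsPreprimitive H α ∨
    (∃ B : Finset α, 2 ≤ B.card ∧ B.card + 2 ≤ Fintype.card α ∧ ∀ h ∈ H, h • B = B) ∨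
    (MulAction.IsPretransitive H α ∧ ∃ B : Finset α, 2 ≤ B.card ∧ B.card < Fintype.card α ∧
      B.card ∣ Fintype.card α ∧ ∀ h ∈ H, h • B = B ∨ Disjoint (h • B) B) := by
  classical
  rw [or_iff_not_imp_left]
  intro hnp
  by_cases ht : MulAction.IsPretransitive H α
  · refine Or.inr ⟨ht, ?_⟩
    obtain ⟨B, hB, hBt⟩ : ∃ B : Set α, MulAction.IsBlock H B ∧ ¬ MulAction.IsTrivialBlock B := by
      by_contra! h
      exact hnp ⟨fun {B} hB => h B hB⟩
    rw [MulAction.IsTrivialBlock, not_or, Set.not_subsingleton_iff] at hBt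
    refine ⟨B.toFinset, ?_, ?_, ?_, fun h hh => ?_⟩
    · rw [Set.toFinset_card, ← Nat.card_eq_fintype_card, Nat.card_coe_set_eq]
      exact (Set.one_lt_ncard_iff_nontrivial).2 hBt.1
    · rw [Finset.card_lt_iff_ne_univ]
      exact fun h => hBt.2 (Set.toFinset_eq_univ.1 h)
    · have := hB.ncard_dvd_card hBt.1.nonempty
      rwa [Nat.card_eq_fintype_card, Set.ncard_eq_toFinset_card'] at this
    · have h1 := (MulAction.isBlock_iff_smul_eq_or_disjoint.1 hB) ⟨h, hh⟩
      have h2 : ((h • B.toFinset : Finset α) : Set α) = (⟨h, hh⟩ : H) • B := by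
        rw [Finset.coe_smul_finset, Set.coe_toFinset]
        rfl
      rw [← Finset.coe_inj, ← Finset.disjoint_coe, h2, Set.coe_toFinset]
      exact h1
  · left
    obtain ⟨a, ha⟩ : ∃ a : α, MulAction.orbit H a ≠ Set.univ := by
      by_contra! h
      have : Nonempty α := Fintype.card_pos_iff.1 (by omega)
      obtain ⟨a⟩ := this
      exact ht ((MulAction.isPretransitive_iff_orbit_eq_univ a).2 (h a))
    set B := (MulAction.orbit H a).toFinset with hBdef
    have hinv : ∀ h ∈ H, ∀ x ∈ B, h • x ∈ B := by
      intro h hh x hx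
      rw [hBdef, Set.mem_toFinset] at hx ⊢
      exact MulAction.mem_orbit_of_mem_orbit (⟨h, hh⟩ : H) hx
    have hinv' : ∀ h ∈ H, h • B = B := by
      intro h hh
      refine Finset.eq_of_subset_of_card_le (fun y hy => ?_) (Finset.card_smul_finset h B).ge
      obtain ⟨x, hx, rfl⟩ := Finset.mem_smul_finset.1 hy
      exact hinv h hh x hx
    have haB : a ∈ B := by rw [hBdef, Set.mem_toFinset]; exact MulAction.mem_orbit_self a
    refine ⟨B, ?_, ?_, hinv'⟩
    · by_contra hc
      have h1 : B.card ≤ 1 := by omega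
      exact hidx (index_eq_of_fixed_point hH hα (a := a) fun h hh =>
        Finset.card_le_one.1 h1 _ (hinv h hh a haB) _ haB)
    · by_contra hc
      have h1 : Bᶜ.card ≤ 1 := by
        have := Finset.card_add_card_compl B
        omega
      obtain ⟨b, hb⟩ : ∃ b, b ∉ B := by
        by_contra! h
        exact ha (Set.toFinset_eq_univ.1 (Finset.eq_univ_of_forall h))
      refine hidx (index_eq_of_fixed_point hH hα (a := b) fun h hh =>
        Finset.card_le_one.1 h1 _ ?_ _ (Finset.mem_compl.2 hb))
      rw [Finset.mem_compl]
      intro hmem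
      have := hinv h⁻¹ (H.inv_mem hh) _ hmem
      rw [inv_smul_smul] at this
      exact hb this

end MaximalSubgroups

section IndexBound

open Equiv Equiv.Perm Pointwise

theorem Nat.choose_le_choose_of_le_of_add_le {m j k : ℕ} (hjk : j ≤ k) (hk : k + j ≤ m) :
    m.choose j ≤ m.choose k := by
  have main : ∀ k, j ≤ k → 2 * k ≤ m → m.choose j ≤ m.choose k := by
    intro k hjk
    induction k, hjk using Nat.le_induction with
    | base => exact fun _ => le_rfl
    | succ k _ ih =>
      exact fun h => (ih (by omega)).trans (Nat.choose_le_succ_of_lt_half_left (by omega))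
  rcases le_total (2 * k) m with h | h
  · exact main k hjk h
  · rw [← Nat.choose_symm (by omega : k ≤ m)]
    exact main (m - k) (by omega) (by omega)

variable {α : Type*} [DecidableEq α] [Fintype α]

theorem exists_alternatingGroup_smul_eq (hα : 3 ≤ Fintype.card α) {B T : Finset α}
    (h : B.card = T.card) : ∃ g : alternatingGroup α, g • B = T := by
  have := Set.powersetCard.isPretransitive_alternatingGroup (α := α) (n := T.card)
    (by rwa [Nat.card_eq_fintype_card])
  obtain ⟨g, hg⟩ := MulAction.exists_smul_eq (alternatingGroup α)
    (⟨B, h⟩ : Set.powersetCard α T.card) ⟨T, rfl⟩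
  exact ⟨g, congrArg Subtype.val hg⟩

variable {H : Subgroup (alternatingGroup α)} {B : Finset α}

theorem smul_eq_smul_of_mem_of_mem (hB : ∀ h ∈ H, h • B = B ∨ Disjoint (h • B) B)
    {g g' : alternatingGroup α} (hg : g⁻¹ * g' ∈ H) {x : α} (hx : x ∈ g • B) (hx' : x ∈ g' • B) :
    g • B = g' • B := by
  rcases hB _ hg with h | h
  · conv_lhs => rw [← h]
    rw [smul_smul, mul_inv_cancel_left]
  · refine absurd h (Finset.not_disjoint_iff.2 ⟨g⁻¹ • x, ?_, ?_⟩)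
    · rw [mul_smul, Finset.smul_mem_smul_finset_iff]
      exact hx'
    · rwa [Finset.inv_smul_mem_iff]

theorem exists_mem_smul_of_isPretransitive (ht : MulAction.IsPretransitive H α)
    (hB : B.Nonempty) (x : α) : ∃ k ∈ H, x ∈ k • B := by
  obtain ⟨b, hb⟩ := hB
  obtain ⟨k, rfl⟩ := MulAction.exists_smul_eq H b x
  exact ⟨k, k.2, Finset.smul_mem_smul_finset hb⟩

theorem card_ne_two_of_isThreeCycle (ht : MulAction.IsPretransitive H α)
    (hB : ∀ h ∈ H, h • B = B ∨ Disjoint (h • B) B) {c : alternatingGroup α} (hc : c ∈ H)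
    (hc3 : (c : Perm α).IsThreeCycle) : B.card ≠ 2 := by
  intro hB2
  obtain ⟨a, b, e, hab, hae, hbe, hce⟩ := hc3.exists_eq_swap_mul_swap
  have hca : c • a = e := by
    rw [Subgroup.smul_def, hce, Perm.smul_def, Perm.mul_apply, swap_apply_of_ne_of_ne hab hae,
      swap_apply_left]
  have hce' : c • e = b := by
    rw [Subgroup.smul_def, hce, Perm.smul_def, Perm.mul_apply, swap_apply_right,
      swap_apply_of_ne_of_ne hab.symm hbe]
  have hcb : c • b = a := by
    rw [Subgroup.smul_def, hce, Perm.smul_def, Perm.mul_apply, swap_apply_left, swap_apply_right]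
  obtain ⟨k, hk, hak⟩ := exists_mem_smul_of_isPretransitive ht (B := B)
    (Finset.card_pos.1 (by omega)) a
  have hcard : (k • B).card = 2 := by rw [Finset.card_smul_finset, hB2]
  have key : ∀ x, x ∈ k • B → c • x ∈ k • B → ∀ y ∈ k • B, c • y ∈ k • B := by
    intro x hx hcx y hy
    rw [smul_eq_smul_of_mem_of_mem hB (g := k) (g' := c * k)
      (H.mul_mem (H.inv_mem hk) (H.mul_mem hc hk)) hcx
      (by rw [mul_smul]; exact Finset.smul_mem_smul_finset hx), mul_smul]
    exact Finset.smul_mem_smul_finset hy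
  have hthree : ¬ (e ∈ k • B ∧ b ∈ k • B) := by
    rintro ⟨he, hb⟩
    have : ({a, b, e} : Finset α) ⊆ k • B := by
      intro x hx
      simp only [Finset.mem_insert, Finset.mem_singleton] at hx
      rcases hx with rfl | rfl | rfl <;> assumption
    have := Finset.card_le_card this
    rw [hcard, Finset.card_eq_three.2 ⟨a, b, e, hab, hae, hbe, rfl⟩] at this
    omega
  obtain ⟨y, hy, hya⟩ := Finset.exists_mem_ne (by omega : 1 < (k • B).card) a
  by_cases hye : y = e
  · subst hye
    exact hthree ⟨hy, hce' ▸ key a hak (hca ▸ hy) _ hy⟩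
  by_cases hyb : y = b
  · subst hyb
    exact hthree ⟨hca ▸ key y hy (hcb ▸ hak) _ hak, hy⟩
  · have hcy : c • y = y := by
      rw [Subgroup.smul_def, hce, Perm.smul_def, Perm.mul_apply, swap_apply_of_ne_of_ne hyb hye,
        swap_apply_of_ne_of_ne hya hye]
    have he := hca ▸ key y hy (hcy.symm ▸ hy) _ hak
    exact hthree ⟨he, hce' ▸ key y hy (hcy.symm ▸ hy) _ he⟩

theorem choose_le_index_of_invariant (hα : 3 ≤ Fintype.card α) (hB : ∀ h ∈ H, h • B = B) :
    (Fintype.card α).choose B.card ≤ H.index := by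
  have := Fintype.ofFinite (alternatingGroup α ⧸ H)
  choose! g hg using fun T (hT : T ∈ Finset.powersetCard B.card Finset.univ) =>
    exists_alternatingGroup_smul_eq hα (Finset.mem_powersetCard.1 hT).2.symm
  rw [← Finset.card_univ, ← Finset.card_powersetCard, Subgroup.index, Nat.card_eq_fintype_card,
    ← Finset.card_univ]
  refine Finset.card_le_card_of_injOn (fun T => (g T : alternatingGroup α ⧸ H))
    (fun _ _ => Finset.mem_coe.2 (Finset.mem_univ _)) fun T hT T' hT' h => ?_
  have h1 := hB _ (QuotientGroup.eq.1 h)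
  rw [← hg T hT, ← hg T' hT', ← h1, smul_smul, mul_inv_cancel_left, h1]

theorem exists_fixing_notMem (hα : 2 * B.card + 2 ≤ Fintype.card α) (hB2 : 2 ≤ B.card)
    (ht : MulAction.IsPretransitive H α) (hB : ∀ h ∈ H, h • B = B ∨ Disjoint (h • B) B) :
    ∃ σ : alternatingGroup α, σ • B = B ∧ σ ∉ H := by
  obtain ⟨u, hu⟩ : ∃ u, u ∉ B := by
    by_contra! h
    have := Finset.card_univ (α := α)
    rw [← Finset.eq_univ_of_forall h] at this
    omega
  obtain ⟨k, hk, huk⟩ := exists_mem_smul_of_isPretransitive ht (B := B)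
    (Finset.card_pos.1 (by omega)) u
  have hdisj : Disjoint (k • B) B := (hB k hk).resolve_left fun h => hu (h ▸ huk)
  have hcard : (k • B).card = B.card := Finset.card_smul_finset k B
  obtain ⟨u', hu', hne⟩ := Finset.exists_mem_ne (by omega : 1 < (k • B).card) u
  obtain ⟨v, hv, w, hw, hvw⟩ : ∃ v ∈ (k • B ∪ B)ᶜ, ∃ w ∈ (k • B ∪ B)ᶜ, v ≠ w := by
    rw [← Finset.one_lt_card, Finset.card_compl, Finset.card_union_of_disjoint hdisj]
    omega
  simp only [Finset.mem_compl, Finset.mem_union, not_or] at hv hw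
  have hu'v : u' ≠ v := fun h => hv.1 (h ▸ hu')
  have hu'w : u' ≠ w := fun h => hw.1 (h ▸ hu')
  have hu'B : u' ∉ B := fun h => Finset.disjoint_left.1 hdisj hu' h
  refine ⟨⟨swap u' v * swap u' w,
    (isThreeCycle_swap_mul_swap_same hu'v hu'w hvw).mem_alternatingGroup⟩, ?_, fun hσ => ?_⟩
  · refine Finset.eq_of_subset_of_card_le (fun y hy => ?_) (Finset.card_smul_finset _ B).ge
    obtain ⟨x, hx, rfl⟩ := Finset.mem_smul_finset.1 hy
    have h1 : ∀ z, z ∉ B → x ≠ z := fun z hz h => hz (h ▸ hx)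
    rwa [Subgroup.smul_def, Perm.smul_def, Perm.mul_apply,
      swap_apply_of_ne_of_ne (h1 _ hu'B) (h1 _ hw.2),
      swap_apply_of_ne_of_ne (h1 _ hu'B) (h1 _ hv.2)]
  · set σ : alternatingGroup α := ⟨swap u' v * swap u' w, _⟩
    have huv : u ≠ v := fun h => hv.1 (h ▸ huk)
    have huw : u ≠ w := fun h => hw.1 (h ▸ huk)
    have hσu : σ • u = u := by
      rw [Subgroup.smul_def, Perm.smul_def, Perm.mul_apply, swap_apply_of_ne_of_ne hne.symm huw,
        swap_apply_of_ne_of_ne hne.symm huv]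
    have hσu' : σ • u' = w := by
      rw [Subgroup.smul_def, Perm.smul_def, Perm.mul_apply, swap_apply_left,
        swap_apply_of_ne_of_ne hu'w.symm hvw.symm]
    have h1 : k • B = (σ * k) • B := smul_eq_smul_of_mem_of_mem hB
      (H.mul_mem (H.inv_mem hk) (H.mul_mem hσ hk)) huk
      (by simpa only [hσu, mul_smul] using Finset.smul_mem_smul_finset (a := σ) huk)
    apply hw.1
    rw [h1, mul_smul, ← hσu']
    exact Finset.smul_mem_smul_finset hu'

theorem choose_le_index_of_block (hα : 3 ≤ Fintype.card α) (hB1 : 1 ≤ B.card)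
    (hB : ∀ h ∈ H, h • B = B ∨ Disjoint (h • B) B) {K : Finset (alternatingGroup α)}
    (hK : ∀ σ ∈ K, σ • B = B) (hK' : ∀ σ ∈ K, ∀ τ ∈ K, σ⁻¹ * τ ∈ H → σ = τ) :
    (Fintype.card α - 1).choose (B.card - 1) * K.card ≤ H.index := by
  have : Nonempty α := Fintype.card_pos_iff.1 (by omega)
  obtain ⟨a⟩ := this
  have hcard : ∀ U ∈ Finset.powersetCard (B.card - 1) (Finset.univ.erase a),
      B.card = (insert a U).card := by
    intro U hU
    rw [Finset.mem_powersetCard] at hU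
    rw [Finset.card_insert_of_notMem fun h => Finset.notMem_erase a _ (hU.1 h), hU.2]
    omega
  have := Fintype.ofFinite (alternatingGroup α ⧸ H)
  choose! g hg using fun U hU => exists_alternatingGroup_smul_eq hα (hcard U hU)
  rw [← Finset.card_univ, ← Finset.card_erase_of_mem (Finset.mem_univ a),
    ← Finset.card_powersetCard, ← Finset.card_product, Subgroup.index, Nat.card_eq_fintype_card,
    ← Finset.card_univ]
  refine Finset.card_le_card_of_injOn
    (fun T => ((g T.1 * T.2 : alternatingGroup α) : alternatingGroup α ⧸ H))
    (fun _ _ => Finset.mem_coe.2 (Finset.mem_univ _)) ?_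
  rintro ⟨U, σ⟩ hU ⟨U', τ⟩ hU' h
  simp only [Finset.coe_product, Set.mem_prod, Finset.mem_coe] at hU hU'
  rw [QuotientGroup.eq] at h
  dsimp only at h
  have h1 : (g U * σ) • B = insert a U := by rw [mul_smul, hK σ hU.2, hg U hU.1]
  have h2 : (g U' * τ) • B = insert a U' := by rw [mul_smul, hK τ hU'.2, hg U' hU'.1]
  have h3 := smul_eq_smul_of_mem_of_mem hB h (x := a) (h1 ▸ Finset.mem_insert_self _ _)
    (h2 ▸ Finset.mem_insert_self _ _)
  rw [h1, h2] at h3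
  have h4 : ∀ W ∈ Finset.powersetCard (B.card - 1) (Finset.univ.erase a),
      (insert a W).erase a = W := fun W hW =>
    Finset.erase_insert fun h => Finset.notMem_erase a _ ((Finset.mem_powersetCard.1 hW).1 h)
  obtain rfl : U = U' := by rw [← h4 U hU.1, h3, h4 U' hU'.1]
  rw [mul_inv_rev, mul_assoc, inv_mul_cancel_left] at h
  rw [hK' σ hU.2 τ hU'.2 h]

/-- A maximal subgroup of the alternating group which is not a point stabilizer has index at least
the number of pairs of points. -/
theorem choose_two_le_index (hH : IsCoatom H) (hα : 9 ≤ Fintype.card α)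
    (hidx : H.index ≠ Fintype.card α) : (Fintype.card α).choose 2 ≤ H.index := by
  by_cases h3 : ∀ g ∈ H, ¬ (g : Perm α).IsThreeCycle
  · have h1 := factorial_le_two_mul_index (by omega) H h3
    rw [Nat.choose_two_right]
    generalize Fintype.card α = m at *
    obtain ⟨t, ht⟩ : ∃ t, (m + 1) / 2 = t + 5 := ⟨(m + 1) / 2 - 5, by omega⟩
    have h2 : (2 * t + 10) * (2 * t + 9) ≤ (t + 5).factorial := by
      clear * -
      induction t with
      | zero => decide
      | succ t ih =>
        rw [show t + 1 + 5 = (t + 5) + 1 by ring, Nat.factorial_succ]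
        nlinarith
    have h4 : m * (m - 1) ≤ (2 * t + 10) * (2 * t + 9) := Nat.mul_le_mul (by omega) (by omega)
    rw [ht] at h1
    omega
  push Not at h3
  obtain ⟨c, hc, hc3⟩ := h3
  rcases maximal_subgroup_trichotomy hH (by omega) hidx with h | ⟨B, hB2, hBm, hB⟩ |
    ⟨ht, B, hB2, hBm, hdvd, hB⟩
  · exact absurd hc3 (not_isThreeCycle_of_isPreprimitive hH.1 h hc)
  · exact (Nat.choose_le_choose_of_le_of_add_le hB2 hBm).trans
      (choose_le_index_of_invariant (by omega) hB)
  · have hB3 := card_ne_two_of_isThreeCycle ht hB hc hc3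
    obtain ⟨r, hr⟩ := hdvd
    have hr2 : 2 ≤ r := by
      by_contra h
      interval_cases r <;> omega
    have hhalf : 2 * B.card ≤ Fintype.card α := by rw [hr]; nlinarith
    by_cases hB4 : B.card = 3
    · obtain ⟨σ, hσB, hσ⟩ := exists_fixing_notMem (by omega) hB2 ht hB
      have hσ1 : (1 : alternatingGroup α) ≠ σ := fun h => hσ (h ▸ H.one_mem)
      have h1 := choose_le_index_of_block (by omega) (by omega) hB (K := {1, σ})
        (by simp [hσB]) (by simp [hσ])
      rw [Finset.card_pair hσ1, hB4] at h1
      refine le_trans ?_ h1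
      obtain ⟨q, hq⟩ : ∃ q, Fintype.card α = q + 9 := ⟨Fintype.card α - 9, by omega⟩
      rw [hq, show q + 9 - 1 = q + 8 by omega, show 3 - 1 = 2 by rfl,
        Nat.choose_succ_succ' (q + 8) 1, Nat.choose_one_right, mul_two, add_comm]
      gcongr
      rw [Nat.choose_two_right, Nat.le_div_iff_mul_le (by norm_num),
        show q + 8 - 1 = q + 7 by omega]
      nlinarith
    · have h1 := choose_le_index_of_block (by omega) (by omega) hB (K := {1}) (by simp) (by simp)
      rw [Finset.card_singleton, mul_one] at h1
      refine le_trans ?_ ((Nat.choose_le_choose_of_le_of_add_le (j := 3)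
        (by omega) (by omega)).trans h1)
      obtain ⟨q, hq⟩ : ∃ q, Fintype.card α = q + 9 := ⟨Fintype.card α - 9, by omega⟩
      have h2 := Nat.add_one_mul_choose_eq (q + 7) 2
      have h5 := Nat.add_one_mul_choose_eq (q + 7) 1
      have h6 := Nat.add_one_mul_choose_eq (q + 8) 1
      simp only [Nat.choose_one_right, Nat.reduceAdd] at h2 h5 h6
      rw [hq, show q + 9 - 1 = q + 8 by omega]
      have h7 : (q + 7).choose 2 * 2 = (q + 7) * (q + 6) := by
        rw [Nat.choose_two_right, Nat.div_mul_cancel (Nat.two_dvd_mul_sub_one _)]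
        rfl
      nlinarith

end IndexBound

section PairOrbits

open Equiv Equiv.Perm Pointwise

variable {α : Type*} [DecidableEq α]

theorem exists_disjoint_pairs_apply_ne {ι : Type*} [DecidableEq ι] (f : α → ι) {R : Finset α}
    (hR : 4 ≤ R.card) (h : ∀ x ∈ R, (R.filter (f · = f x)).card + 2 ≤ R.card) :
    ∃ a ∈ R, ∃ b ∈ R, ∃ c ∈ R, ∃ d ∈ R, f a ≠ f b ∧ f c ≠ f d ∧ a ≠ c ∧ a ≠ d ∧ b ≠ c ∧ b ≠ d := by
  obtain ⟨a, ha, hmax⟩ := R.exists_max_image (fun x => (R.filter (f · = f x)).card)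
    (Finset.card_pos.1 (by omega))
  obtain ⟨b, hb, hab⟩ : ∃ b ∈ R, f b ≠ f a := by
    by_contra! hc
    have := h a ha
    rw [Finset.filter_true_of_mem hc] at this
    omega
  have hne : a ≠ b := fun e => hab (e ▸ rfl)
  have hcard : ((R.erase a).erase b).card + 2 = R.card := by
    rw [Finset.card_erase_of_mem (Finset.mem_erase.2 ⟨hne.symm, hb⟩), Finset.card_erase_of_mem ha]
    omega
  obtain ⟨c, hc⟩ : ((R.erase a).erase b).Nonempty := Finset.card_pos.1 (by omega)
  simp only [Finset.mem_erase] at hc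
  obtain ⟨hcb, hca, hcR⟩ := hc
  by_contra! hcon
  have hall : ∀ d ∈ (R.erase a).erase b, f d = f c := by
    intro d hd
    simp only [Finset.mem_erase] at hd
    by_contra hdc
    exact hd.1 (hcon a ha b hb c hcR d hd.2.2 hab.symm (Ne.symm hdc) hca.symm hd.2.1.symm
      hcb.symm).symm
  by_cases hfc : f c = f a
  · have h1 : R.erase b ⊆ R.filter (f · = f a) := by
      intro d hd
      rw [Finset.mem_erase] at hd
      refine Finset.mem_filter.2 ⟨hd.2, ?_⟩
      by_cases hda : d = a
      · rw [hda]
      · rw [hall d (by simp [hda, hd.1, hd.2]), hfc]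
    have := Finset.card_le_card h1
    rw [Finset.card_erase_of_mem hb] at this
    have := h a ha
    omega
  · have h1 : (R.erase a).erase b ⊆ R.filter (f · = f c) := by
      intro d hd
      refine Finset.mem_filter.2 ⟨?_, hall d hd⟩
      exact Finset.mem_of_mem_erase (Finset.mem_of_mem_erase hd)
    have h2 : R.filter (f · = f a) ⊆ {a} := by
      intro d hd
      rw [Finset.mem_filter] at hd
      rw [Finset.mem_singleton]
      by_contra hda
      have hdb : d ≠ b := fun e => hab (e ▸ hd.2)
      exact hfc ((hall d (by simp [hda, hdb, hd.1])).symm.trans hd.2)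
    have h3 := Finset.card_le_card h1
    have h4 := Finset.card_le_card h2
    have h5 := hmax c hcR
    rw [Finset.card_singleton] at h4
    omega

variable [Fintype α]

theorem exists_pairs_of_fibers {ι : Type*} [DecidableEq ι] (f : α → ι) (hα : 9 ≤ Fintype.card α)
    (h2 : ∀ x, 2 ≤ (Finset.univ.filter (f · = f x)).card)
    (hm : ∀ x, (Finset.univ.filter (f · = f x)).card + 2 ≤ Fintype.card α) :
    ∃ u₁ u₂ u₃ u₄ v₁ v₂ v₃ v₄ : α, [u₁, u₂, u₃, u₄, v₁, v₂, v₃, v₄].Nodup ∧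
      f u₁ = f u₂ ∧ f u₃ = f u₄ ∧ f v₁ ≠ f v₂ ∧ f v₃ ≠ f v₄ := by
  suffices hs : ∃ u₁ u₂ u₃ u₄, [u₁, u₂, u₃, u₄].Nodup ∧ f u₁ = f u₂ ∧ f u₃ = f u₄ ∧
      ∀ x, (({u₁, u₂, u₃, u₄} : Finset α)ᶜ.filter (f · = f x)).card + 6 ≤ Fintype.card α by
    obtain ⟨u₁, u₂, u₃, u₄, hU, h12, h34, hR⟩ := hs
    have hcard : ({u₁, u₂, u₃, u₄} : Finset α).card = 4 := by
      have := List.toFinset_card_of_nodup hU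
      simpa using this
    obtain ⟨a, ha, b, hb, c, hc, d, hd, hab, hcd, hac, had, hbc, hbd⟩ :=
      exists_disjoint_pairs_apply_ne f (R := ({u₁, u₂, u₃, u₄} : Finset α)ᶜ)
        (by rw [Finset.card_compl]; omega)
        fun x _ => by have := hR x; rw [Finset.card_compl]; omega
    refine ⟨u₁, u₂, u₃, u₄, a, b, c, d, ?_, h12, h34, hab, hcd⟩
    have hab' : a ≠ b := fun e => hab (e ▸ rfl)
    have hcd' : c ≠ d := fun e => hcd (e ▸ rfl)
    simp only [Finset.mem_compl, Finset.mem_insert, Finset.mem_singleton, List.nodup_cons,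
      List.mem_cons, List.not_mem_nil] at *
    grind
  have hle : ∀ U T : Finset α, ∀ x, T ⊆ U → (∀ t ∈ T, f t = f x) →
      (Uᶜ.filter (f · = f x)).card + T.card ≤ (Finset.univ.filter (f · = f x)).card := by
    intro U T x hTU hT
    rw [← Finset.card_union_of_disjoint]
    · refine Finset.card_le_card fun y hy => ?_
      rcases Finset.mem_union.1 hy with h | h
      · exact Finset.mem_filter.2 ⟨Finset.mem_univ _, (Finset.mem_filter.1 h).2⟩
      · exact Finset.mem_filter.2 ⟨Finset.mem_univ _, hT y h⟩
    · refine Finset.disjoint_left.2 fun y hy hyT => ?_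
      exact Finset.mem_compl.1 (Finset.mem_filter.1 hy).1 (hTU hyT)
  have hdisj : ∀ x y, f x ≠ f y →
      Disjoint (Finset.univ.filter (f · = f x)) (Finset.univ.filter (f · = f y)) := by
    intro x y hxy
    exact Finset.disjoint_filter.2 fun z _ hx hy => hxy (hx.symm.trans hy)
  obtain ⟨a, -, hmax⟩ := Finset.univ.exists_max_image
    (fun x => (Finset.univ.filter (f · = f x)).card)
    (Finset.card_pos.1 (by rw [Finset.card_univ]; omega))
  have hma := hm a
  by_cases h6 : 6 ≤ (Finset.univ.filter (f · = f a)).card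
  · obtain ⟨u₁, hu₁, u₂, hu₂, u₃, hu₃, u₄, hu₄, h12, h13, h14, h23, h24, h34⟩ :=
      Finset.three_lt_card.1 (by omega : 3 < (Finset.univ.filter (f · = f a)).card)
    simp only [Finset.mem_filter, Finset.mem_univ, true_and] at hu₁ hu₂ hu₃ hu₄
    refine ⟨u₁, u₂, u₃, u₄, by simp [*], by rw [hu₁, hu₂], by rw [hu₃, hu₄], fun x => ?_⟩
    by_cases hx : f x = f a
    · have := hle {u₁, u₂, u₃, u₄} {u₁, u₂, u₃, u₄} x subset_rfl (by simp [*])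
      rw [Finset.card_eq_four.2 ⟨u₁, u₂, u₃, u₄, h12, h13, h14, h23, h24, h34, rfl⟩] at this
      have := hm x
      omega
    · have h1 := Finset.card_le_univ
        (Finset.univ.filter (f · = f x) ∪ Finset.univ.filter (f · = f a))
      rw [Finset.card_union_of_disjoint (hdisj x a hx)] at h1
      have := hle {u₁, u₂, u₃, u₄} ∅ x (by simp) (by simp)
      omega
  · obtain ⟨b, hb⟩ : ∃ b, f b ≠ f a := by
      by_contra! hc
      rw [Finset.filter_true_of_mem fun x _ => hc x, Finset.card_univ] at hma
      omega
    obtain ⟨u₁, hu₁, u₂, hu₂, h12⟩ := Finset.one_lt_card.1 (h2 a)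
    obtain ⟨u₃, hu₃, u₄, hu₄, h34⟩ := Finset.one_lt_card.1 (h2 b)
    simp only [Finset.mem_filter, Finset.mem_univ, true_and] at hu₁ hu₂ hu₃ hu₄
    refine ⟨u₁, u₂, u₃, u₄, ?_, by rw [hu₁, hu₂], by rw [hu₃, hu₄], fun x => ?_⟩
    · simp only [List.nodup_cons, List.mem_cons, List.not_mem_nil]
      grind
    have hxa := hmax x (Finset.mem_univ x)
    by_cases hx : f x = f a
    · have := hle {u₁, u₂, u₃, u₄} {u₁, u₂} x (by grind) (by simp [*])
      rw [Finset.card_pair h12] at this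
      omega
    by_cases hx' : f x = f b
    · have := hle {u₁, u₂, u₃, u₄} {u₃, u₄} x (by grind) (by simp [*])
      rw [Finset.card_pair h34] at this
      omega
    · have h1 := Finset.card_le_univ ((Finset.univ.filter (f · = f x) ∪
        Finset.univ.filter (f · = f a)) ∪ Finset.univ.filter (f · = f b))
      rw [Finset.card_union_of_disjoint (Finset.disjoint_union_left.2
        ⟨hdisj x b hx', hdisj a b hb.symm⟩), Finset.card_union_of_disjoint (hdisj x a hx)] at h1
      have := hle {u₁, u₂, u₃, u₄} ∅ x (by simp) (by simp)
      have := h2 b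
      omega

/-- A double-coset condition on `H`, expressing that the action on the cosets of `H` is transitive
on unordered pairs of cosets. -/
def PairHomogeneous {G : Type*} [Group G] (H : Subgroup G) : Prop :=
  ∀ c ∉ H, ∀ g ∉ H, ∃ h₁ ∈ H, ∃ h₂ ∈ H, g = h₁ * c * h₂ ∨ g = h₁ * c⁻¹ * h₂

variable {H : Subgroup (alternatingGroup α)}

theorem exists_isThreeCycle_notMem (hH : H ≠ ⊤) :
    ∃ c : alternatingGroup α, (c : Perm α).IsThreeCycle ∧ c ∉ H := by
  by_contra! h
  apply hH
  rw [eq_top_iff, ← Subgroup.map_subtype_le_map_subtype, ← MonoidHom.range_eq_map,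
    Subgroup.range_subtype]
  exact closure_three_cycles_eq_alternating.ge.trans ((Subgroup.closure_le _).2 fun c hc =>
    ⟨⟨c, hc.mem_alternatingGroup⟩, h ⟨c, hc.mem_alternatingGroup⟩ hc, rfl⟩)

theorem Equiv.Perm.IsThreeCycle.conj {g : Perm α} (hg : g.IsThreeCycle) (h : Perm α) :
    (h * g * h⁻¹).IsThreeCycle := by
  rw [IsThreeCycle, cycleType_conj]
  exact hg

theorem PairHomogeneous.exists_isThreeCycle (hp : PairHomogeneous H) (hH : H ≠ ⊤)
    {g : alternatingGroup α} (hg : g ∉ H) :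
    ∃ c : alternatingGroup α, (c : Perm α).IsThreeCycle ∧ c⁻¹ * g ∈ H := by
  obtain ⟨c, hc3, hc⟩ := exists_isThreeCycle_notMem hH
  obtain ⟨h₁, hh₁, h₂, hh₂, rfl | rfl⟩ := hp c hc g hg
  · refine ⟨h₁ * c * h₁⁻¹, hc3.conj h₁, ?_⟩
    convert H.mul_mem hh₁ hh₂ using 1
    group
  · refine ⟨h₁ * c⁻¹ * h₁⁻¹, hc3.inv.conj h₁, ?_⟩
    convert H.mul_mem hh₁ hh₂ using 1
    group

theorem not_pairHomogeneous_of_fibers (hH : H ≠ ⊤) {ι : Type*} [DecidableEq ι] (f : α → ι)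
    (hα : 9 ≤ Fintype.card α)
    (h2 : ∀ x, 2 ≤ (Finset.univ.filter (f · = f x)).card)
    (hm : ∀ x, (Finset.univ.filter (f · = f x)).card + 2 ≤ Fintype.card α)
    (hf : ∀ h ∈ H, ∀ x y, f x = f y → f (h • x) = f (h • y)) : ¬ PairHomogeneous H := by
  intro hp
  obtain ⟨u₁, u₂, u₃, u₄, v₁, v₂, v₃, v₄, hnd, hu12, hu34, hv12, hv34⟩ :=
    exists_pairs_of_fibers f hα h2 hm
  have hf' : ∀ h ∈ H, ∀ x y, f (h • x) = f (h • y) → f x = f y := by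
    intro h hh x y hxy
    simpa using hf _ (H.inv_mem hh) _ _ hxy
  simp only [List.nodup_cons, List.mem_cons, List.not_mem_nil] at hnd
  let g : alternatingGroup α := ⟨swap u₁ v₁ * swap u₂ v₂ * (swap u₃ v₃ * swap u₄ v₄), by
    rw [mem_alternatingGroup, Perm.sign_mul, Perm.sign_mul, Perm.sign_mul, sign_swap (by grind),
      sign_swap (by grind), sign_swap (by grind), sign_swap (by grind)]
    rfl⟩
  have hgu : g • u₁ = v₁ ∧ g • u₂ = v₂ ∧ g • u₃ = v₃ ∧ g • u₄ = v₄ ∧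
      g • v₁ = u₁ ∧ g • v₂ = u₂ ∧ g • v₃ = u₃ ∧ g • v₄ = u₄ := by
    simp only [g, Subgroup.smul_def, Perm.smul_def, Perm.mul_apply, swap_apply_def]
    grind
  obtain ⟨gu₁, gu₂, gu₃, gu₄, gv₁, gv₂, gv₃, gv₄⟩ := hgu
  have hg : g ∉ H := fun hg => hv12 (gu₁ ▸ gu₂ ▸ hf g hg _ _ hu12)
  obtain ⟨c, hc3, hc⟩ := hp.exists_isThreeCycle hH hg
  have key : ∀ x y x' y', g • x = x' → g • y = y' → ¬ (f x = f y ↔ f x' = f y') →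
      x' ∈ (c : Perm α).support ∨ y' ∈ (c : Perm α).support := by
    intro x y x' y' hx hy hxy
    by_contra! hcon
    rw [notMem_support, notMem_support] at hcon
    have hcx : c⁻¹ • x' = x' := inv_smul_eq_iff.2 hcon.1.symm
    have hcy : c⁻¹ • y' = y' := inv_smul_eq_iff.2 hcon.2.symm
    have h1 := hf _ hc x y
    have h2 := hf' _ hc x y
    rw [mul_smul, mul_smul, hx, hy, hcx, hcy] at h1 h2
    exact hxy ⟨h1, h2⟩
  have k1 := key _ _ _ _ gu₁ gu₂ (by tauto)
  have k2 := key _ _ _ _ gu₃ gu₄ (by tauto)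
  have k3 := key _ _ _ _ gv₁ gv₂ (by tauto)
  have k4 := key _ _ _ _ gv₃ gv₄ (by tauto)
  obtain ⟨x, y, z, -, -, -, hs⟩ := Finset.card_eq_three.1 hc3.card_support
  simp only [hs, Finset.mem_insert, Finset.mem_singleton] at k1 k2 k3 k4
  grind

theorem not_pairHomogeneous_of_invariant (hH : H ≠ ⊤) (hα : 9 ≤ Fintype.card α) {B : Finset α}
    (hB2 : 2 ≤ B.card) (hBm : B.card + 2 ≤ Fintype.card α) (hB : ∀ h ∈ H, h • B = B) :
    ¬ PairHomogeneous H := by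
  have hcompl := Finset.card_compl B
  have hfib : ∀ x, Finset.univ.filter (fun y => decide (y ∈ B) = decide (x ∈ B)) = B ∨
      Finset.univ.filter (fun y => decide (y ∈ B) = decide (x ∈ B)) = Bᶜ := by
    intro x
    by_cases hx : x ∈ B
    · left; ext; simp [hx]
    · right; ext; simp [hx]
  refine not_pairHomogeneous_of_fibers hH (fun x => decide (x ∈ B)) hα (fun x => ?_) (fun x => ?_)
    fun h hh x y hxy => ?_
  · rcases hfib x with h | h <;> rw [h] <;> omega
  · rcases hfib x with h | h <;> rw [h] <;> omega
  · have : ∀ z, h • z ∈ B ↔ z ∈ B := fun z => by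
      conv_lhs => rw [← hB h hh]
      exact Finset.smul_mem_smul_finset_iff h
    simpa [this] using hxy

theorem not_pairHomogeneous_of_block (hH : H ≠ ⊤) (hα : 9 ≤ Fintype.card α) {B : Finset α}
    (ht : MulAction.IsPretransitive H α) (hB2 : 2 ≤ B.card) (hBm : B.card < Fintype.card α)
    (hdvd : B.card ∣ Fintype.card α) (hB : ∀ h ∈ H, h • B = B ∨ Disjoint (h • B) B) :
    ¬ PairHomogeneous H := by
  choose k hk hmem using exists_mem_smul_of_isPretransitive ht (B := B)
    (Finset.card_pos.1 (by omega))
  have heq : ∀ x y, x ∈ k y • B ↔ k x • B = k y • B := fun x y =>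
    ⟨fun h => smul_eq_smul_of_mem_of_mem hB (H.mul_mem (H.inv_mem (hk _)) (hk _)) (hmem x) h,
      fun h => h ▸ hmem x⟩
  have hfib : ∀ x, (Finset.univ.filter fun y => k y • B = k x • B).card = B.card := by
    intro x
    simp only [← heq]
    simp
  refine not_pairHomogeneous_of_fibers hH (fun x => k x • B) hα (fun x => ?_) (fun x => ?_)
    fun h hh x y hxy => ?_
  · rw [hfib]
    exact hB2
  · rw [hfib]
    obtain ⟨r, hr⟩ := hdvd
    have : 2 ≤ r := by
      by_contra h
      interval_cases r <;> omega
    rw [hr]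
    nlinarith
  · have : ∀ z, k (h • z) • B = (h * k z) • B := fun z =>
      smul_eq_smul_of_mem_of_mem hB
        (H.mul_mem (H.inv_mem (hk _)) (H.mul_mem hh (hk _))) (hmem (h • z))
        (by rw [mul_smul]; exact Finset.smul_mem_smul_finset (hmem z))
    rw [this, this, mul_smul, mul_smul, hxy]

end PairOrbits

section PrimitiveSubgroups

open Equiv Equiv.Perm Pointwise

variable {α : Type*} [DecidableEq α] [Fintype α] {H : Subgroup (alternatingGroup α)}

theorem card_isThreeCycle_mul_three (hα : 3 ≤ Fintype.card α) :
    (Finset.univ.filter fun c : alternatingGroup α => (c : Perm α).cycleType = {3}).card * 3 =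
      Fintype.card α * (Fintype.card α - 1) * (Fintype.card α - 2) := by
  have h := AlternatingGroup.card_of_cycleType_mul_eq α {3}
  have hsum : (({3} : Multiset ℕ).sum ≤ Fintype.card α ∧ ∀ a ∈ ({3} : Multiset ℕ), 2 ≤ a) ∧
      Even (({3} : Multiset ℕ).sum + ({3} : Multiset ℕ).card) := by
    refine ⟨⟨by simpa using hα, by simp⟩, by decide⟩
  rw [if_pos hsum] at h
  obtain ⟨q, hq⟩ : ∃ q, Fintype.card α = q + 3 := ⟨Fintype.card α - 3, by omega⟩
  rw [hq] at h ⊢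
  simp only [Multiset.sum_singleton, Multiset.prod_singleton, Nat.add_sub_cancel,
    Multiset.toFinset_singleton, Finset.prod_singleton, Multiset.count_singleton_self,
    Nat.factorial_succ, Nat.factorial_zero] at h ⊢
  have := Nat.factorial_pos q
  apply Nat.eq_of_mul_eq_mul_right this
  rw [show q + 3 - 1 = q + 2 by omega, show q + 3 - 2 = q + 1 by omega]
  linarith

theorem exists_card_isThreeCycle_eq (hp : PairHomogeneous H) (hH : H ≠ ⊤)
    (h3 : ∀ g ∈ H, ¬ (g : Perm α).IsThreeCycle) :
    ∃ t, (Finset.univ.filter fun c : alternatingGroup α => (c : Perm α).cycleType = {3}).card =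
      (H.index - 1) * t := by
  classical
  have := Fintype.ofFinite (alternatingGroup α ⧸ H)
  obtain ⟨g₀, hg₀3, hg₀⟩ := exists_isThreeCycle_notMem hH
  set C := Finset.univ.filter fun c : alternatingGroup α => (c : Perm α).cycleType = {3}
  set N : alternatingGroup α → ℕ := fun g => (C.filter fun c => c⁻¹ * g ∈ H).card
  have hmem : ∀ c, c ∈ C ↔ (c : Perm α).IsThreeCycle := by simp [C, IsThreeCycle]
  have hconj : ∀ c ∈ C, ∀ g, g * c * g⁻¹ ∈ C := fun c hc g => by
    rw [hmem] at hc ⊢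
    exact hc.conj g
  have hle : ∀ g, ∀ h₁ ∈ H, ∀ h₂ ∈ H, N g ≤ N (h₁ * g * h₂) := by
    intro g h₁ hh₁ h₂ hh₂
    refine Finset.card_le_card_of_injOn (fun c => h₁ * c * h₁⁻¹) (fun c hc => ?_)
      fun c _ d _ h => by simpa using h
    rw [Finset.mem_coe, Finset.mem_filter] at hc ⊢
    refine ⟨hconj c hc.1 _, ?_⟩
    convert H.mul_mem (H.mul_mem hh₁ hc.2) hh₂ using 1
    group
  have hinv : ∀ g, N g ≤ N g⁻¹ := by
    intro g
    refine Finset.card_le_card_of_injOn (fun c => g⁻¹ * c⁻¹ * g) (fun c hc => ?_)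
      fun c _ d _ h => by simpa using h
    rw [Finset.mem_coe, Finset.mem_filter] at hc ⊢
    refine ⟨?_, ?_⟩
    · have : c⁻¹ ∈ C := by
        rw [hmem]
        exact ((hmem c).1 hc.1).inv
      simpa using hconj _ this g⁻¹
    · convert H.inv_mem hc.2 using 1
      group
  have hconst : ∀ g ∉ H, N g = N g₀ := by
    have hle' : ∀ c ∉ H, ∀ g ∉ H, N c ≤ N g := by
      intro c hc g hg
      obtain ⟨h₁, hh₁, h₂, hh₂, rfl | rfl⟩ := hp c hc g hg
      · exact hle _ _ hh₁ _ hh₂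
      · exact (hinv c).trans (hle _ _ hh₁ _ hh₂)
    exact fun g hg => (hle' _ hg _ hg₀).antisymm (hle' _ hg₀ _ hg)
  refine ⟨N g₀, ?_⟩
  have hmaps : Set.MapsTo (fun c : alternatingGroup α => (c : alternatingGroup α ⧸ H)) C
      (Finset.univ.erase ((1 : alternatingGroup α) : alternatingGroup α ⧸ H) : Finset _) := by
    intro c hc
    rw [Finset.mem_coe, Finset.mem_erase]
    refine ⟨fun h => h3 c ?_ ((hmem c).1 hc), Finset.mem_univ _⟩
    simpa using QuotientGroup.eq.1 h
  rw [Finset.card_eq_sum_card_fiberwise hmaps, Finset.sum_const_nat (m := N g₀),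
    Finset.card_erase_of_mem (Finset.mem_univ _), Finset.card_univ, Subgroup.index,
    Nat.card_eq_fintype_card]
  intro x hx
  induction x using QuotientGroup.induction_on with
  | H g =>
    rw [← hconst g]
    · simp only [N, QuotientGroup.eq]
    · intro hg
      refine (Finset.mem_erase.1 hx).1 (QuotientGroup.eq.2 ?_)
      simpa using hg

theorem ninety_dvd_card_of_seven_dvd_card (hα : Fintype.card α = 10)
    (hprim : MulAction.IsPreprimitive H α) (h7 : 7 ∣ Nat.card H) : 90 ∣ Nat.card H := by
  let φ := (alternatingGroup α).subtype.subgroupMap H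
  let f : α →ₑ[φ] α := {
      toFun := id
      map_smul' _ _ := rfl }
  have hprim' : MulAction.IsPreprimitive (H.map (alternatingGroup α).subtype) α := by
    rwa [← MulAction.isPreprimitive_congr (f := f)
      ((alternatingGroup α).subtype.subgroupMap_surjective H) Function.bijective_id]
  have hcard : Nat.card (H.map (alternatingGroup α).subtype) = Nat.card H :=
    Subgroup.card_map_of_injective (alternatingGroup α).subtype_injective
  rw [← hcard] at h7 ⊢
  have : Fact (Nat.Prime 7) := ⟨by norm_num⟩
  obtain ⟨g, hg⟩ := exists_prime_orderOf_dvd_card' 7 h7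
  have hg' : orderOf (g : Perm α) = 7 := by rw [Subgroup.orderOf_coe, hg]
  have hcyc : (g : Perm α).IsCycle := isCycle_of_prime_order' (by rw [hg']; norm_num) (by omega)
  have hsupp : (g : Perm α).support.card = 7 := by rw [← hcyc.orderOf, hg']
  have h2 := hprim'.is_two_pretransitive (s := ((g : Perm α).support : Set α)ᶜ) (n := 2)
    (by rw [← Finset.coe_compl, Set.ncard_coe_finset, Finset.card_compl, hsupp, hα])
    (by rw [Nat.card_eq_fintype_card, hα]; norm_num)
    (isPretransitive_of_isCycle_mem hcyc g.2)
  have : 2 ≤ Fintype.card α := by omega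
  obtain ⟨x⟩ : Nonempty (Fin 2 ↪ α) := Function.Embedding.nonempty_of_card_le (by simpa using this)
  have h3 := @MulAction.index_stabilizer_of_transitive _ _ _ _ x h2
  have h4 := Subgroup.index_dvd_card (MulAction.stabilizer (H.map (alternatingGroup α).subtype) x)
  rw [h3, Nat.card_eq_fintype_card, Fintype.card_embedding_eq, hα, Fintype.card_fin] at h4
  exact h4

theorem false_of_homogeneous_degree {m n t h : ℕ} (hm : 9 ≤ m)
    (h1 : ((m + 1) / 2).factorial ≤ 2 * (n + 1)) (h2 : n * t * 3 = m * (m - 1) * (m - 2))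
    (hc : 2 * (h * (n + 1)) = m.factorial) (h90 : m = 10 → 7 ∣ h → 90 ∣ h) : False := by
  have ht0 : 0 < t := by
    refine Nat.pos_of_ne_zero ?_
    rintro rfl
    obtain ⟨q, rfl⟩ : ∃ q, m = q + 9 := ⟨m - 9, by omega⟩
    rw [show q + 9 - 1 = q + 8 by omega, show q + 9 - 2 = q + 7 by omega] at h2
    simp at h2
  have hlow : m ≤ 12 := by
    by_contra! hm13
    have h4 : n * 3 ≤ m * (m - 1) * (m - 2) := by
      rw [← h2, mul_right_comm]
      exact Nat.le_mul_of_pos_right _ ht0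
    obtain ⟨s, hs⟩ : ∃ s, (m + 1) / 2 = s + 7 := ⟨(m + 1) / 2 - 7, by omega⟩
    have h5 : 2 * ((2 * s + 14) * (2 * s + 13) * (2 * s + 12)) + 6 < 3 * (s + 7).factorial := by
      clear * -
      induction s with
      | zero => decide
      | succ s ih =>
        rw [show s + 1 + 7 = (s + 7) + 1 by ring, Nat.factorial_succ]
        have h := Nat.mul_lt_mul_of_pos_left ih (by omega : 0 < s + 8)
        have : 0 ≤ s ^ 2 ∧ 0 ≤ s ^ 3 ∧ 0 ≤ s ^ 4 := ⟨by positivity, by positivity, by positivity⟩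
        linarith
    have h6 : m * (m - 1) * (m - 2) ≤ (2 * s + 14) * (2 * s + 13) * (2 * s + 12) :=
      Nat.mul_le_mul (Nat.mul_le_mul (by omega) (by omega)) (by omega)
    rw [hs] at h1
    omega
  interval_cases m <;> simp only [Nat.reduceAdd, Nat.reduceDiv, Nat.reduceSub, Nat.reduceMul,
    Nat.factorial_succ, Nat.factorial_zero] at h1 h2 hc
  · have : t < 5 := by nlinarith
    interval_cases t
    · obtain rfl : n = 168 := by omega
      omega
    · obtain rfl : n = 84 := by omega
      omega
    all_goals omega
  · have : t < 5 := by nlinarith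
    interval_cases t
    · obtain rfl : n = 240 := by omega
      omega
    · obtain rfl : n = 120 := by omega
      omega
    · obtain rfl : n = 80 := by omega
      obtain rfl : h = 22400 := by omega
      exact absurd (h90 rfl (by norm_num)) (by norm_num)
    · obtain rfl : n = 60 := by omega
      omega
  · have : t < 1 := by nlinarith
    omega
  · have : t < 2 := by nlinarith
    obtain rfl : t = 1 := by omega
    obtain rfl : n = 440 := by omega
    omega

theorem not_pairHomogeneous_of_isPreprimitive (hH : H ≠ ⊤) (hα : 9 ≤ Fintype.card α)
    (hprim : MulAction.IsPreprimitive H α) : ¬ PairHomogeneous H := by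
  intro hp
  have h3 : ∀ g ∈ H, ¬ (g : Perm α).IsThreeCycle := fun g hg =>
    not_isThreeCycle_of_isPreprimitive hH hprim hg
  have h1 := factorial_le_two_mul_index (by omega) H h3
  obtain ⟨t, ht⟩ := exists_card_isThreeCycle_eq hp hH h3
  have h2 := card_isThreeCycle_mul_three (α := α) (by omega)
  rw [ht] at h2
  have hcard : 2 * Nat.card (alternatingGroup α) = (Fintype.card α).factorial := by
    have : Nontrivial α := Fintype.one_lt_card_iff_nontrivial.1 (by omega)
    rw [two_mul_nat_card_alternatingGroup, Nat.card_perm, Nat.card_eq_fintype_card]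
  obtain ⟨n, hn⟩ := Nat.exists_eq_succ_of_ne_zero H.index_ne_zero_of_finite
  rw [← H.card_mul_index, hn] at hcard
  rw [hn] at h1 h2
  exact false_of_homogeneous_degree hα h1 h2 hcard
    fun h => ninety_dvd_card_of_seven_dvd_card h hprim

/-- A maximal subgroup of the alternating group which is not a point stabilizer does not act
transitively on the unordered pairs of its cosets. -/
theorem not_pairHomogeneous (hH : IsCoatom H) (hα : 9 ≤ Fintype.card α)
    (hidx : H.index ≠ Fintype.card α) : ¬ PairHomogeneous H := by
  rcases maximal_subgroup_trichotomy hH (by omega) hidx with h | ⟨B, hB2, hBm, hB⟩ |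
    ⟨ht, B, hB2, hBm, hdvd, hB⟩
  · exact not_pairHomogeneous_of_isPreprimitive hH.1 hα h
  · exact not_pairHomogeneous_of_invariant hH.1 hα hB2 hBm hB
  · exact not_pairHomogeneous_of_block hH.1 hα ht hB2 hBm hdvd hB

end PrimitiveSubgroups

section CosetPairs

theorem PairHomogeneous.map {G G' : Type*} [Group G] [Group G'] {K : Subgroup G}
    (hK : PairHomogeneous K) (e : G ≃* G') : PairHomogeneous (K.map e.toMonoidHom) := by
  intro c hc g hg
  rw [Subgroup.mem_map_equiv] at hc hg
  obtain ⟨h₁, hh₁, h₂, hh₂, h⟩ := hK _ hc _ hg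
  refine ⟨e h₁, ⟨h₁, hh₁, rfl⟩, e h₂, ⟨h₂, hh₂, rfl⟩, h.imp (fun h => ?_) fun h => ?_⟩
  · rw [← e.apply_symm_apply g, h]
    simp
  · rw [← e.apply_symm_apply g, h]
    simp

theorem exists_pairs_of_not_pairHomogeneous {G α : Type*} [Group G] [MulAction G α] {a : α}
    (h : ¬ PairHomogeneous (MulAction.stabilizer G a)) :
    ∃ x y z w : α, x ≠ y ∧ z ≠ w ∧ ∀ g : G, s(g • x, g • y) ≠ s(z, w) := by
  rw [PairHomogeneous] at h
  push Not at h
  obtain ⟨c, hc, g, hg, hcg⟩ := h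
  refine ⟨a, c • a, a, g • a, fun h => hc h.symm, fun h => hg h.symm, fun k hk => ?_⟩
  rw [Sym2.eq_iff] at hk
  rcases hk with ⟨h₁, h₂⟩ | ⟨h₁, h₂⟩
  · refine (hcg k h₁ ((k * c)⁻¹ * g) ?_).1 (by group)
    rw [MulAction.mem_stabilizer_iff, mul_smul, ← h₂, inv_smul_eq_iff, mul_smul]
  · refine (hcg (k * c) ((mul_smul k c a).trans h₂) (k⁻¹ * g) ?_).2 (by group)
    rw [MulAction.mem_stabilizer_iff, mul_smul, ← h₁, inv_smul_smul]

theorem factorial_lt_two_mul_four_pow {m : ℕ} (hm : 9 ≤ m) :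
    m.factorial < 2 * 4 ^ ((m.choose 2 - 2) / 3) := by
  induction m, hm using Nat.le_induction with
  | base => decide
  | succ m hm ih =>
    have hpow : ∀ q, 3 ≤ q → 3 * q + 3 ≤ 4 ^ q := fun q hq => by
      induction q, hq using Nat.le_induction with
      | base => norm_num
      | succ q _ ih => rw [pow_succ]; omega
    have h1 := hpow (m / 3) (by omega)
    have h2 : m.choose 2 - 2 ≥ 34 := by
      have := Nat.choose_le_choose 2 hm
      rw [show Nat.choose 9 2 = 36 by decide] at this
      omega
    have h3 : (m.choose 2 - 2) / 3 + m / 3 ≤ ((m + 1).choose 2 - 2) / 3 := by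
      rw [show (m + 1).choose 2 = m + m.choose 2 by simp [Nat.choose_succ_succ' m 1]]
      omega
    calc (m + 1).factorial = (m + 1) * m.factorial := Nat.factorial_succ m
      _ < (m + 1) * (2 * 4 ^ ((m.choose 2 - 2) / 3)) := by gcongr
      _ ≤ 4 ^ (m / 3) * (2 * 4 ^ ((m.choose 2 - 2) / 3)) := by gcongr; omega
      _ = 2 * 4 ^ ((m.choose 2 - 2) / 3 + m / 3) := by ring
      _ ≤ _ := by gcongr; norm_num

theorem factorial_lt_two_mul_eight_pow {m : ℕ} (hm : 9 ≤ m) :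
    m.factorial < 2 * 8 ^ ((m.choose 2 - 2) / 5) := by
  obtain rfl | h10 := hm.eq_or_lt
  · decide
  clear hm
  replace h10 : 10 ≤ m := h10
  induction m, h10 using Nat.le_induction with
  | base => decide
  | succ m hm ih =>
    have hpow : ∀ q, 2 ≤ q → 5 * q + 5 ≤ 8 ^ q := fun q hq => by
      induction q, hq using Nat.le_induction with
      | base => norm_num
      | succ q _ ih => rw [pow_succ]; omega
    have h1 := hpow (m / 5) (by omega)
    have h2 : m.choose 2 - 2 ≥ 34 := by
      have := Nat.choose_le_choose 2 hm
      rw [show Nat.choose 10 2 = 45 by decide] at this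
      omega
    have h3 : (m.choose 2 - 2) / 5 + m / 5 ≤ ((m + 1).choose 2 - 2) / 5 := by
      rw [show (m + 1).choose 2 = m + m.choose 2 by simp [Nat.choose_succ_succ' m 1]]
      omega
    calc (m + 1).factorial = (m + 1) * m.factorial := Nat.factorial_succ m
      _ < (m + 1) * (2 * 8 ^ ((m.choose 2 - 2) / 5)) := by gcongr
      _ ≤ 8 ^ (m / 5) * (2 * 8 ^ ((m.choose 2 - 2) / 5)) := by gcongr; omega
      _ = 2 * 8 ^ ((m.choose 2 - 2) / 5 + m / 5) := by ring
      _ ≤ _ := by gcongr; norm_num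

end CosetPairs

/-- if `X ≤ Aₙ` is a primitive subgroup isomorphic to `A_m`, `n > m ≥ 9`,
and `F` is an algebraically closed field (of arbitrary characteristic), then every
`F Aₙ`-module `V` of dimension `> 1` is reducible as an `F X`-module. -/
theorem stmt0 {F : Type*} [Field F] [IsAlgClosed F] {n m : ℕ} (hm : 9 ≤ m) (hmn : m < n)
    (X : Subgroup (alternatingGroup (Fin n)))
    (hiso : Nonempty (X ≃* alternatingGroup (Fin m)))
    (hprim : IsPrimitiveAction X (Fin n))
    (V : Type*) [AddCommGroup V] [Module F V]
    (ρ : Representation F (alternatingGroup (Fin n)) V)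
    (hdim : 1 < Module.rank F V) :
    ¬ RepIrreducible (ρ.comp X.subtype) := by
  intro hirr
  obtain ⟨e⟩ := hiso
  have htrans := hprim.1
  have hpre : MulAction.IsPreprimitive X (Fin n) := { isTrivialBlock_of_isBlock := hprim.2 _ }
  have : Nontrivial (Fin n) := Fin.nontrivial_iff_two_le.2 (by omega)
  let a : Fin n := ⟨0, by omega⟩
  set H := (MulAction.stabilizer X a).map e.toMonoidHom
  have hH : IsCoatom H := (e.mapSubgroup.isCoatom_iff _).2
    ((MulAction.isCoatom_stabilizer_iff_preprimitive X a).2 hpre)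
  have hidx : H.index = n := by
    rw [show H.index = (MulAction.stabilizer X a).index from Subgroup.index_map_equiv _ e,
      MulAction.index_stabilizer_of_transitive, Nat.card_fin]
  have hα : 9 ≤ Fintype.card (Fin m) := by rwa [Fintype.card_fin]
  have hne : H.index ≠ Fintype.card (Fin m) := by
    rw [hidx, Fintype.card_fin]
    exact hmn.ne'
  have hchoose := choose_two_le_index hH hα hne
  rw [hidx, Fintype.card_fin] at hchoose
  obtain ⟨x, y, z, w, hxy, hzw, hpairs⟩ := exists_pairs_of_not_pairHomogeneous (G := X) (a := a)
    fun hp => not_pairHomogeneous hH hα hne (hp.map e)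
  have hpairs' : ∃ x y z w : Fin n, x ≠ y ∧ z ≠ w ∧ ∀ g ∈ X, s(g • x, g • y) ≠ s(z, w) :=
    ⟨x, y, z, w, hxy, hzw, fun g hg => hpairs ⟨g, hg⟩⟩
  have hsq : 2 * Module.finrank F V ^ 2 ≤ m.factorial := by
    have : Nontrivial (Fin m) := Fin.nontrivial_iff_two_le.2 (by omega)
    have h := hirr.finrank_sq_le
    rw [Nat.card_congr e.toEquiv] at h
    have h2 := two_mul_nat_card_alternatingGroup (α := Fin m)
    rw [Nat.card_perm, Nat.card_fin] at h2
    omega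
  by_cases h3 : (3 : F) = 0
  · have h2 : (2 : F) ≠ 0 := fun h2 => one_ne_zero (by linear_combination h3 - h2 : (1 : F) = 0)
    have h5 : ((5 : ℕ) : F) ≠ 0 := fun h5 => h2 (by push_cast at h5; linear_combination h5 - h3)
    have hbound := pow_le_finrank_sq_of_irreducible_restriction (p := 5) (k := (m.choose 2 - 2) / 5)
      (by norm_num) (by norm_num) h5 (Or.inr h2) (by rw [Fintype.card_fin]; omega)
      (by rw [Fintype.card_fin]; omega) X hprim hpairs' ρ hdim hirr
    have := factorial_lt_two_mul_eight_pow hm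
    norm_num at hbound
    omega
  · have hbound := pow_le_finrank_sq_of_irreducible_restriction (p := 3) (k := (m.choose 2 - 2) / 3)
      (by norm_num) (by norm_num) (by exact_mod_cast h3) (Or.inl rfl)
      (by rw [Fintype.card_fin]; omega)
      (by rw [Fintype.card_fin]; omega) X hprim hpairs' ρ hdim hirr
    have := factorial_lt_two_mul_four_pow hm
    norm_num at hbound
    omega
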